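/- (Three spheres inequality with lower-order terms) Fix κ > 0 and M₀ > 0. Let A = (a^{ij}) : closure(Ω) → ℝ^{n×n} be symmetric with continuously differentiable entries, with sup norms and Lipschitz constants of all entries bounded by M₀, and elliptic with constant κ: ∑_{i,j} a^{ij}(x) ξ_i ξ_j ≥ κ|ξ|² for all x ∈ Ω and ξ ∈ ℝⁿ. Let b : Ω → ℝⁿ and c : Ω → ℝ be measurable with ‖b‖_{L^∞(Ω)} ≤ M₀ and ‖c‖_{L^∞(Ω)} ≤ M₀. Then there exist C > 0 and s ∈ (0,1), depending only on n, the diameter of Ω, κ and M₀, such that: for every v ∈ C²(Ω) satisfying ∑_{i,j} ∂_i(a^{ij} ∂_j v) + b·∇v + c v = 0 pointwise in Ω, every y ∈ Ω and every r with 0 < r < dist(y, ∂Ω)/3, one has r ‖v‖_{H¹(B(y,2r))} ≤ C ‖v‖_{H¹(B(y,r))}^{s} ‖v‖_{H¹(B(y,3r))}^{1−s}. -/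

import Mathlib

open MeasureTheory Metric Set
open scoped RealInnerProductSpace

noncomputable section

/-- The `i`-th partial derivative of a real-valued function on `ℝⁿ`. -/
noncomputable def pd {n : ℕ} (i : Fin n) (f : EuclideanSpace ℝ (Fin n) → ℝ)
    (x : EuclideanSpace ℝ (Fin n)) : ℝ :=
  fderiv ℝ f x (EuclideanSpace.single i 1)

/-- `u` is a classical solution of `L_q u = ∑ᵢⱼ ∂ᵢ (aⁱʲ ∂ⱼ u) + q u = 0` pointwise in `Ω`. -/
def IsSolution {n : ℕ} (A : Fin n → Fin n → EuclideanSpace ℝ (Fin n) → ℝ)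
    (q u : EuclideanSpace ℝ (Fin n) → ℝ) (Ω : Set (EuclideanSpace ℝ (Fin n))) : Prop :=
  ∀ x ∈ Ω, (∑ i, ∑ j, pd i (fun y => A i j y * pd j u y) x) + q x * u x = 0

/-- The `H¹(D)` norm `(∫_D (w² + ‖∇w‖²))^{1/2}`. -/
noncomputable def H1Norm {n : ℕ} (D : Set (EuclideanSpace ℝ (Fin n)))
    (w : EuclideanSpace ℝ (Fin n) → ℝ) : ℝ :=
  (∫ x in D, ((w x) ^ 2 + ‖fderiv ℝ w x‖ ^ 2)) ^ (1 / 2 : ℝ)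

/-- `A = (aⁱʲ)` is symmetric, has `C¹` entries on `closure Ω`, and is uniformly elliptic. -/
def EllipticSym {n : ℕ} (Ω : Set (EuclideanSpace ℝ (Fin n)))
    (A : Fin n → Fin n → EuclideanSpace ℝ (Fin n) → ℝ) : Prop :=
  (∀ i j, ∀ x ∈ closure Ω, A i j x = A j i x) ∧
  (∀ i j, ContDiffOn ℝ 1 (A i j) (closure Ω)) ∧
  (∃ lam > 0, ∀ x ∈ Ω, ∀ ξ : EuclideanSpace ℝ (Fin n),
    lam * ‖ξ‖ ^ 2 ≤ ∑ i, ∑ j, A i j x * ξ i * ξ j)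

/-- Euclidean space. -/
abbrev ES (n : ℕ) := EuclideanSpace ℝ (Fin n)

section Calc
variable {n : ℕ}

lemma pd_congr {i : Fin n} {f g : (ES n) → ℝ} {x : (ES n)} (h : f =ᶠ[nhds x] g) : pd i f x = pd i g x := by
  unfold pd; rw [h.fderiv_eq]

lemma pd_add {i : Fin n} {f g : (ES n) → ℝ} {x : (ES n)} (hf : DifferentiableAt ℝ f x)
    (hg : DifferentiableAt ℝ g x) : pd i (fun y => f y + g y) x = pd i f x + pd i g x := by
  unfold pd; rw [fderiv_fun_add hf hg]; rfl

lemma pd_sub {i : Fin n} {f g : (ES n) → ℝ} {x : (ES n)} (hf : DifferentiableAt ℝ f x)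
    (hg : DifferentiableAt ℝ g x) : pd i (fun y => f y - g y) x = pd i f x - pd i g x := by
  unfold pd; rw [fderiv_fun_sub hf hg]; rfl

lemma pd_mul {i : Fin n} {f g : (ES n) → ℝ} {x : (ES n)} (hf : DifferentiableAt ℝ f x)
    (hg : DifferentiableAt ℝ g x) :
    pd i (fun y => f y * g y) x = pd i f x * g x + f x * pd i g x := by
  unfold pd; rw [fderiv_fun_mul hf hg]; simp; ring

lemma pd_const_mul {i : Fin n} {f : (ES n) → ℝ} {x : (ES n)} (c : ℝ) (hf : DifferentiableAt ℝ f x) :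
    pd i (fun y => c * f y) x = c * pd i f x := by
  unfold pd; rw [fderiv_const_mul hf]; simp

lemma pd_sum {ι : Type*} {s : Finset ι} {i : Fin n} {f : ι → (ES n) → ℝ} {x : (ES n)}
    (hf : ∀ j ∈ s, DifferentiableAt ℝ (f j) x) :
    pd i (fun y => ∑ j ∈ s, f j y) x = ∑ j ∈ s, pd i (f j) x := by
  unfold pd; rw [fderiv_fun_sum hf]; simp

lemma pd_exp {i : Fin n} {f : (ES n) → ℝ} {x : (ES n)} (hf : DifferentiableAt ℝ f x) :
    pd i (fun y => Real.exp (f y)) x = Real.exp (f x) * pd i f x := by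
  unfold pd; rw [fderiv_exp hf]; simp

lemma coord_contDiff {k : WithTop ℕ∞} (j : Fin n) : ContDiff ℝ k (fun x : ES n => x j) := by
  fun_prop

lemma pd_coord (i j : Fin n) (x : ES n) : pd i (fun y : ES n => y j) x = if i = j then 1 else 0 := by
  unfold pd
  have : (fun y : ES n => y j) = (EuclideanSpace.proj j : (ES n) →L[ℝ] ℝ) := by ext; simp
  rw [this, ContinuousLinearMap.fderiv]
  simp [eq_comm]

lemma pd_contDiff {f : (ES n) → ℝ} (hf : ContDiff ℝ 2 f) (i : Fin n) : ContDiff ℝ 1 (pd i f) := by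
  unfold pd
  have : ContDiff ℝ 1 (fderiv ℝ f) := hf.fderiv_right (by norm_num)
  fun_prop

lemma pd_continuous {f : (ES n) → ℝ} (hf : ContDiff ℝ 1 f) (i : Fin n) : Continuous (pd i f) := by
  unfold pd
  have : Continuous (fderiv ℝ f) := hf.continuous_fderiv (by norm_num)
  fun_prop

lemma pd_comm {f : (ES n) → ℝ} (hf : ContDiff ℝ 2 f) (i j : Fin n) (x : ES n) :
    pd i (pd j f) x = pd j (pd i f) x := by
  have hs : IsSymmSndFDerivAt ℝ f x := hf.contDiffAt.isSymmSndFDerivAt (by simp)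
  have hd : DifferentiableAt ℝ (fderiv ℝ f) x :=
    ((hf.fderiv_right (m := 1) (by norm_num)).differentiable (by norm_num)) x
  have key : ∀ i j : Fin n, pd i (pd j f) x
      = fderiv ℝ (fderiv ℝ f) x (EuclideanSpace.single i 1) (EuclideanSpace.single j 1) := by
    intro i j
    unfold pd
    rw [fderiv_clm_apply hd (by fun_prop)]
    simp
  rw [key, key]
  exact hs _ _

lemma pd_compact {f : (ES n) → ℝ} (hf : HasCompactSupport f) (i : Fin n) :
    HasCompactSupport (pd i f) := hf.fderiv_apply ℝ _

lemma integral_pd_zero {f : (ES n) → ℝ} (hf : ContDiff ℝ 1 f) (hc : HasCompactSupport f) (i : Fin n) :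
    ∫ x, pd i f x = 0 := by
  have hi : Integrable (fun x => pd i f x) :=
    (pd_continuous hf i).integrable_of_hasCompactSupport (pd_compact hc i)
  have h := integral_mul_fderiv_eq_neg_fderiv_mul_of_integrable (𝕜 := ℝ) (μ := volume)
    (f := fun _ : ES n => (1:ℝ)) (g := f) (v := EuclideanSpace.single i 1)
    (by simp) (by simpa [pd] using hi)
    (by simpa using hf.continuous.integrable_of_hasCompactSupport hc)
    (by fun_prop) (fun x _ => hf.differentiable (by norm_num) x)
  simpa [pd] using h

lemma normsq_fderiv {f : (ES n) → ℝ} (x : ES n) : ‖fderiv ℝ f x‖ ^ 2 = ∑ i, (pd i f x) ^ 2 := by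
  set L := fderiv ℝ f x
  rw [← (InnerProductSpace.toDual ℝ (ES n)).symm.norm_map L, EuclideanSpace.norm_sq_eq]
  refine Finset.sum_congr rfl fun i _ => ?_
  have : ((InnerProductSpace.toDual ℝ (ES n)).symm L) i = pd i f x := by
    have h := InnerProductSpace.toDual_symm_apply (𝕜 := ℝ) (x := EuclideanSpace.single i (1:ℝ)) (y := L)
    rw [EuclideanSpace.inner_single_right] at h
    simpa [pd] using h
  rw [this]; simp

end Calc

section Ident
variable {n : ℕ}

lemma dAt {f : (ES n) → ℝ} (hf : ContDiff ℝ 1 f) (x : ES n) : DifferentiableAt ℝ f x :=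
  hf.differentiable (by norm_num) x

/-- The field `A x`. -/
def Yv (A : Fin n → Fin n → (ES n) → ℝ) (i : Fin n) (x : ES n) : ℝ := ∑ j, A i j x * x j
/-- The quadratic form `A x · x`. -/
def pp (A : Fin n → Fin n → (ES n) → ℝ) (x : ES n) : ℝ := ∑ i, x i * Yv A i x
/-- The flux `A ∇w`. -/
def fl (A : Fin n → Fin n → (ES n) → ℝ) (w : (ES n) → ℝ) (i : Fin n) (x : ES n) : ℝ := ∑ j, A i j x * pd j w x
/-- The principal operator `div (A ∇w)`. -/
def Lop (A : Fin n → Fin n → (ES n) → ℝ) (w : (ES n) → ℝ) (x : ES n) : ℝ := ∑ i, pd i (fl A w i) x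
/-- The energy density `A ∇w · ∇w`. -/
def QQ (A : Fin n → Fin n → (ES n) → ℝ) (w : (ES n) → ℝ) (x : ES n) : ℝ := ∑ i, pd i w x * fl A w i x
/-- The derivative of `w` along `A x`. -/
def Yd (A : Fin n → Fin n → (ES n) → ℝ) (w : (ES n) → ℝ) (x : ES n) : ℝ := ∑ i, Yv A i x * pd i w x
/-- The divergence of `A x`. -/
def dY (A : Fin n → Fin n → (ES n) → ℝ) (x : ES n) : ℝ := ∑ i, pd i (Yv A i) x
/-- The multiplier. -/
def mm (l : ℝ) (A : Fin n → Fin n → (ES n) → ℝ) (w : (ES n) → ℝ) (x : ES n) : ℝ :=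
  Yd A w x - l * (pp A x * w x)
/-- The Gaussian weight. -/
def ph (l : ℝ) (x : ES n) : ℝ := Real.exp (-(l / 2) * ∑ i, x i * x i)
/-- The vector field of the Carleman identity. -/
def FF (l s : ℝ) (A : Fin n → Fin n → (ES n) → ℝ) (w : (ES n) → ℝ) (i : Fin n) (x : ES n) : ℝ :=
  ph l x * (mm l A w x * fl A w i x - 1 / 2 * (Yv A i x * QQ A w x))
    + (s ^ 2 / 2) * ((ph l x * (ph l x * ph l x)) * (pp A x * ((w x * w x) * Yv A i x)))
/-- The error term of the Carleman identity. -/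
def KT (A : Fin n → Fin n → (ES n) → ℝ) (w : (ES n) → ℝ) (x : ES n) : ℝ :=
  (∑ i, fl A w i x * ∑ j, pd i (Yv A j) x * pd j w x)
    - 1 / 2 * ∑ i, Yv A i x * ∑ j, ∑ k, pd i (A j k) x * pd j w x * pd k w x

variable {A : Fin n → Fin n → (ES n) → ℝ} {w : (ES n) → ℝ}

lemma Yv_c (hA : ∀ i j, ContDiff ℝ 1 (A i j)) (i : Fin n) : ContDiff ℝ 1 (Yv A i) := by
  unfold Yv
  exact ContDiff.sum fun j _ => (hA i j).mul (coord_contDiff j)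

lemma pp_c (hA : ∀ i j, ContDiff ℝ 1 (A i j)) : ContDiff ℝ 1 (pp A) := by
  unfold pp
  exact ContDiff.sum fun j _ => (coord_contDiff j).mul (Yv_c hA j)

lemma fl_c (hA : ∀ i j, ContDiff ℝ 1 (A i j)) (hw : ContDiff ℝ 2 w) (i : Fin n) :
    ContDiff ℝ 1 (fl A w i) := by
  unfold fl
  exact ContDiff.sum fun j _ => (hA i j).mul (pd_contDiff hw j)

lemma QQ_c (hA : ∀ i j, ContDiff ℝ 1 (A i j)) (hw : ContDiff ℝ 2 w) :
    ContDiff ℝ 1 (QQ A w) := by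
  unfold QQ
  exact ContDiff.sum fun j _ => (pd_contDiff hw j).mul (fl_c hA hw j)

lemma Yd_c (hA : ∀ i j, ContDiff ℝ 1 (A i j)) (hw : ContDiff ℝ 2 w) :
    ContDiff ℝ 1 (Yd A w) := by
  unfold Yd
  exact ContDiff.sum fun j _ => (Yv_c hA j).mul (pd_contDiff hw j)

lemma mm_c (l : ℝ) (hA : ∀ i j, ContDiff ℝ 1 (A i j)) (hw : ContDiff ℝ 2 w) :
    ContDiff ℝ 1 (mm l A w) := by
  unfold mm
  exact (Yd_c hA hw).sub (contDiff_const.mul ((pp_c hA).mul (hw.of_le (by norm_num))))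

lemma ph_c {k : WithTop ℕ∞} (l : ℝ) : ContDiff ℝ k (ph l : (ES n) → ℝ) := by
  unfold ph
  refine ContDiff.exp (contDiff_const.mul ?_)
  exact ContDiff.sum fun j _ => (coord_contDiff j).mul (coord_contDiff j)

lemma ph_pos (l : ℝ) (x : ES n) : 0 < ph l x := Real.exp_pos _

lemma pd_ph (l : ℝ) (i : Fin n) (x : ES n) : pd i (ph l) x = -l * (ph l x * x i) := by
  have hc : ∀ j ∈ (Finset.univ : Finset (Fin n)),
      DifferentiableAt ℝ (fun y : ES n => y j * y j) x := fun j _ => by fun_prop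
  have h1 : pd i (fun y : ES n => ∑ j, y j * y j) x = 2 * x i := by
    rw [pd_sum hc]
    have : ∀ j, pd i (fun y : ES n => y j * y j) x = if i = j then 2 * x j else 0 := by
      intro j
      rw [pd_mul (by fun_prop) (by fun_prop), pd_coord]
      split_ifs <;> ring
    simp [this]
  have hs : DifferentiableAt ℝ (fun y : ES n => ∑ j, y j * y j) x := by fun_prop
  have : pd i (ph l) x = ph l x * pd i (fun y : ES n => -(l / 2) * ∑ j, y j * y j) x :=
    pd_exp (hs.const_mul _)
  rw [this, pd_const_mul _ hs, h1]; ring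

lemma sum_x_fl (hs : ∀ i j x, A i j x = A j i x) (x : ES n) :
    ∑ i, x i * fl A w i x = Yd A w x := by
  unfold fl Yd Yv
  simp_rw [Finset.mul_sum, Finset.sum_mul]
  rw [Finset.sum_comm]
  refine Finset.sum_congr rfl fun i _ => Finset.sum_congr rfl fun j _ => ?_
  rw [hs j i]; ring

lemma pd_fl (hA : ∀ i j, ContDiff ℝ 1 (A i j)) (hw : ContDiff ℝ 2 w) (i j : Fin n) (x : ES n) :
    pd i (fl A w j) x = ∑ k, (pd i (A j k) x * pd k w x + A j k x * pd i (pd k w) x) := by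
  unfold fl
  rw [pd_sum fun k _ => dAt ((hA j k).mul (pd_contDiff hw k)) x]
  exact Finset.sum_congr rfl fun k _ => pd_mul (dAt (hA j k) x) (dAt (pd_contDiff hw k) x)

lemma pd_QQ (hA : ∀ i j, ContDiff ℝ 1 (A i j)) (hs : ∀ i j x, A i j x = A j i x)
    (hw : ContDiff ℝ 2 w) (i : Fin n) (x : ES n) :
    pd i (QQ A w) x = 2 * ∑ j, pd i (pd j w) x * fl A w j x
      + ∑ j, ∑ k, pd i (A j k) x * pd j w x * pd k w x := by
  have h1 : pd i (QQ A w) x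
      = ∑ j, (pd i (pd j w) x * fl A w j x + pd j w x * pd i (fl A w j) x) := by
    unfold QQ
    rw [pd_sum fun k _ => dAt ((pd_contDiff hw k).mul (fl_c hA hw k)) x]
    exact Finset.sum_congr rfl fun k _ => pd_mul (dAt (pd_contDiff hw k) x) (dAt (fl_c hA hw k) x)
  have h2 : ∑ j, pd j w x * (∑ k, A j k x * pd i (pd k w) x)
      = ∑ j, pd i (pd j w) x * fl A w j x := by
    unfold fl
    simp_rw [Finset.mul_sum]
    rw [Finset.sum_comm]
    refine Finset.sum_congr rfl fun a _ => Finset.sum_congr rfl fun b _ => ?_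
    rw [hs b a]; ring
  have h3 : ∑ j, pd j w x * (∑ k, pd i (A j k) x * pd k w x)
      = ∑ j, ∑ k, pd i (A j k) x * pd j w x * pd k w x := by
    simp_rw [Finset.mul_sum]
    refine Finset.sum_congr rfl fun a _ => Finset.sum_congr rfl fun b _ => ?_
    ring
  rw [h1, Finset.sum_add_distrib]
  simp_rw [pd_fl hA hw, Finset.sum_add_distrib, mul_add, Finset.sum_add_distrib]
  rw [h2, h3]; ring

lemma pd_Yd (hA : ∀ i j, ContDiff ℝ 1 (A i j)) 
    (hw : ContDiff ℝ 2 w) (i : Fin n) (x : ES n) :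
    pd i (Yd A w) x = ∑ j, pd i (Yv A j) x * pd j w x + ∑ j, Yv A j x * pd i (pd j w) x := by
  unfold Yd
  rw [pd_sum fun k _ => dAt ((Yv_c hA k).mul (pd_contDiff hw k)) x, ← Finset.sum_add_distrib]
  exact Finset.sum_congr rfl fun k _ => pd_mul (dAt (Yv_c hA k) x) (dAt (pd_contDiff hw k) x)

lemma key_term (hA : ∀ i j, ContDiff ℝ 1 (A i j)) (hs : ∀ i j x, A i j x = A j i x)
    (hw : ContDiff ℝ 2 w) (x : ES n) :
    (∑ i, fl A w i x * pd i (Yd A w) x) - 1 / 2 * ∑ i, Yv A i x * pd i (QQ A w) x = KT A w x := by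
  have h : ∑ i, fl A w i x * (∑ j, Yv A j x * pd i (pd j w) x)
      = ∑ i, Yv A i x * (∑ j, pd i (pd j w) x * fl A w j x) := by
    simp_rw [Finset.mul_sum]
    rw [Finset.sum_comm]
    refine Finset.sum_congr rfl fun a _ => Finset.sum_congr rfl fun b _ => ?_
    rw [pd_comm hw b a]; ring
  have h2 : ∑ i, Yv A i x * (2 * ∑ j, pd i (pd j w) x * fl A w j x)
      = 2 * ∑ i, Yv A i x * (∑ j, pd i (pd j w) x * fl A w j x) := by
    rw [Finset.mul_sum]
    exact Finset.sum_congr rfl fun a _ => by ring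
  unfold KT
  simp_rw [pd_Yd hA hw, pd_QQ hA hs hw, mul_add, Finset.sum_add_distrib]
  rw [h, h2]; ring

lemma pd_FF (l s : ℝ) (hA : ∀ i j, ContDiff ℝ 1 (A i j)) 
    (hw : ContDiff ℝ 2 w) (i : Fin n) (x : ES n) :
    pd i (FF l s A w i) x =
      pd i (ph l) x * (mm l A w x * fl A w i x - 1 / 2 * (Yv A i x * QQ A w x))
      + ph l x * ((pd i (Yd A w) x - l * (pd i (pp A) x * w x + pp A x * pd i w x)) * fl A w i x
          + mm l A w x * pd i (fl A w i) x
          - 1 / 2 * (pd i (Yv A i) x * QQ A w x + Yv A i x * pd i (QQ A w) x))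
      + (s ^ 2 / 2) * (3 * ph l x ^ 2 * pd i (ph l) x * (pp A x * ((w x * w x) * Yv A i x))
        + ph l x ^ 3 * (pd i (pp A) x * ((w x * w x) * Yv A i x)
          + pp A x * (2 * w x * pd i w x * Yv A i x + w x * w x * pd i (Yv A i) x))) := by
  have hw1 : ContDiff ℝ 1 w := hw.of_le (by norm_num)
  have cY := Yv_c hA i
  have cp := pp_c hA
  have cf := fl_c hA hw i
  have cQ := QQ_c hA hw
  have cYd := Yd_c hA hw
  have cm := mm_c l hA hw
  have cph : ContDiff ℝ 1 (ph l : (ES n) → ℝ) := ph_c l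
  have hm : pd i (mm l A w) x = pd i (Yd A w) x - l * (pd i (pp A) x * w x + pp A x * pd i w x) := by
    unfold mm
    rw [pd_sub (dAt cYd x) (dAt (contDiff_const.mul (cp.mul hw1)) x),
      pd_const_mul _ (dAt (cp.mul hw1) x), pd_mul (dAt cp x) (dAt hw1 x)]
  have c1 := cm.mul cf
  have c2 := cY.mul cQ
  have c2' : ContDiff ℝ 1 fun y => (1 / 2 : ℝ) * (Yv A i y * QQ A w y) := contDiff_const.mul c2
  have c3 := cph.mul (cph.mul cph)
  have c4 := cp.mul ((hw1.mul hw1).mul cY)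
  unfold FF
  rw [pd_add (dAt (cph.mul (c1.sub c2')) x) (dAt (contDiff_const.mul (c3.mul c4)) x),
    pd_mul (dAt cph x) (dAt (c1.sub c2') x), pd_sub (dAt c1 x) (dAt c2' x),
    pd_mul (dAt cm x) (dAt cf x), pd_const_mul _ (dAt c2 x), pd_mul (dAt cY x) (dAt cQ x),
    pd_const_mul _ (dAt (c3.mul c4) x), pd_mul (dAt c3 x) (dAt c4 x),
    pd_mul (dAt cph x) (dAt (cph.mul cph) x), pd_mul (dAt cph x) (dAt cph x),
    pd_mul (dAt cp x) (dAt ((hw1.mul hw1).mul cY) x), pd_mul (dAt (hw1.mul hw1) x) (dAt cY x),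
    pd_mul (dAt hw1 x) (dAt hw1 x), hm]
  ring

lemma FF_c (l s : ℝ) (hA : ∀ i j, ContDiff ℝ 1 (A i j)) 
    (hw : ContDiff ℝ 2 w) (i : Fin n) : ContDiff ℝ 1 (FF l s A w i) := by
  have hw1 : ContDiff ℝ 1 w := hw.of_le (by norm_num)
  have cY := Yv_c hA i
  have cp := pp_c hA
  have cf := fl_c hA hw i
  have cQ := QQ_c hA hw
  have cm := mm_c l hA hw
  have cph : ContDiff ℝ 1 (ph l : (ES n) → ℝ) := ph_c l
  unfold FF
  fun_prop

/-- The pointwise Carleman identity. -/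
lemma div_FF (l s : ℝ) (hA : ∀ i j, ContDiff ℝ 1 (A i j)) (hs : ∀ i j x, A i j x = A j i x)
    (hw : ContDiff ℝ 2 w) (x : ES n) :
    ph l x * (Lop A w x + s ^ 2 * ph l x ^ 2 * pp A x * w x) * mm l A w x
      - ∑ i, pd i (FF l s A w i) x
    = ph l x * (l * Yd A w x * (Yd A w x - l * (pp A x * w x)) - KT A w x
        + l * w x * (∑ i, pd i (pp A) x * fl A w i x)
        + 1 / 2 * l * pp A x * QQ A w x + 1 / 2 * dY A x * QQ A w x
        + s ^ 2 * ph l x ^ 2 * w x ^ 2 * (1 / 2 * l * pp A x ^ 2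
            - 1 / 2 * ((∑ i, pd i (pp A) x * Yv A i x) + pp A x * dY A x))) := by
  have e : ∑ i, pd i (FF l s A w i) x =
      -l * ph l x * mm l A w x * (∑ i, x i * fl A w i x)
      + l / 2 * ph l x * QQ A w x * (∑ i, x i * Yv A i x)
      + ph l x * ((∑ i, fl A w i x * pd i (Yd A w) x) - 1 / 2 * ∑ i, Yv A i x * pd i (QQ A w) x)
      - l * ph l x * w x * (∑ i, pd i (pp A) x * fl A w i x)
      - l * ph l x * pp A x * (∑ i, pd i w x * fl A w i x)
      + ph l x * mm l A w x * (∑ i, pd i (fl A w i) x)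
      - 1 / 2 * ph l x * QQ A w x * (∑ i, pd i (Yv A i) x)
      + (s ^ 2 / 2) * (-3 * l * ph l x ^ 3 * pp A x * w x ^ 2 * (∑ i, x i * Yv A i x)
        + ph l x ^ 3 * w x ^ 2 * (∑ i, pd i (pp A) x * Yv A i x)
        + 2 * ph l x ^ 3 * pp A x * w x * (∑ i, Yv A i x * pd i w x)
        + ph l x ^ 3 * pp A x * w x ^ 2 * (∑ i, pd i (Yv A i) x)) := by
    simp only [Finset.mul_sum, ← Finset.sum_add_distrib, ← Finset.sum_sub_distrib]
    refine Finset.sum_congr rfl fun i _ => ?_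
    rw [pd_FF l s hA hw, pd_ph]; ring
  rw [e, sum_x_fl hs, key_term hA hs hw]
  change _ = _
  have e1 : ∑ i, x i * Yv A i x = pp A x := rfl
  have e2 : ∑ i, pd i w x * fl A w i x = QQ A w x := rfl
  have e3 : ∑ i, pd i (fl A w i) x = Lop A w x := rfl
  have e4 : ∑ i, pd i (Yv A i) x = dY A x := rfl
  have e5 : ∑ i, Yv A i x * pd i w x = Yd A w x := rfl
  rw [e1, e2, e3, e4, e5]
  unfold mm
  ring

end Ident

section Bounds
variable {n : ℕ}

/-- Global coefficient class after localisation to the ball of radius three. -/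
structure Good (κ M : ℝ) (A : Fin n → Fin n → ES n → ℝ) : Prop where
  c1 : ∀ i j, ContDiff ℝ 1 (A i j)
  symm : ∀ i j x, A i j x = A j i x
  bd : ∀ i j x, ‖x‖ < 3 → |A i j x| ≤ M
  dbd : ∀ i j k x, ‖x‖ < 3 → |pd k (A i j) x| ≤ M
  ell : ∀ x, ‖x‖ < 3 → ∀ ξ : ES n, κ * ‖ξ‖ ^ 2 ≤ ∑ i, ∑ j, A i j x * ξ i * ξ j

lemma sum_bd {f : Fin n → ℝ} {B : ℝ} (h : ∀ i, |f i| ≤ B) : |∑ i, f i| ≤ n * B := by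
  refine (Finset.abs_sum_le_sum_abs _ _).trans ?_
  refine (Finset.sum_le_card_nsmul _ _ B fun i _ => h i).trans ?_
  simp

lemma mul_bd {a b x y : ℝ} (h1 : |a| ≤ x) (h2 : |b| ≤ y) : |a * b| ≤ x * y := by
  rw [abs_mul]
  exact mul_le_mul h1 h2 (abs_nonneg _) ((abs_nonneg _).trans h1)

lemma add_bd {a b x y : ℝ} (h1 : |a| ≤ x) (h2 : |b| ≤ y) : |a + b| ≤ x + y :=
  (abs_add_le a b).trans (add_le_add h1 h2)

lemma abs_coord_le (x : ES n) (i : Fin n) : |x i| ≤ ‖x‖ := by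
  simpa using PiLp.norm_apply_le x i

/-- Euclidean norm of the gradient. -/
def gr (w : ES n → ℝ) (x : ES n) : ℝ := Real.sqrt (∑ i, (pd i w x) ^ 2)

lemma gr_nonneg (w : ES n → ℝ) (x : ES n) : 0 ≤ gr w x := Real.sqrt_nonneg _

lemma gr_sq (w : ES n → ℝ) (x : ES n) : gr w x ^ 2 = ∑ i, (pd i w x) ^ 2 :=
  Real.sq_sqrt (Finset.sum_nonneg fun _ _ => sq_nonneg _)

lemma pd_le_gr (w : ES n → ℝ) (x : ES n) (i : Fin n) : |pd i w x| ≤ gr w x := by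
  apply Real.abs_le_sqrt
  exact Finset.single_le_sum (f := fun i => (pd i w x) ^ 2) (fun _ _ => sq_nonneg _)
    (Finset.mem_univ i)

lemma pd_Yv {A : Fin n → Fin n → ES n → ℝ} (hA : ∀ i j, ContDiff ℝ 1 (A i j)) (k j : Fin n)
    (x : ES n) : pd k (Yv A j) x = ∑ l, (pd k (A j l) x * x l + A j l x * if k = l then 1 else 0) := by
  unfold Yv
  rw [pd_sum fun l _ => dAt ((hA j l).mul (coord_contDiff l)) x]
  refine Finset.sum_congr rfl fun l _ => ?_
  rw [pd_mul (dAt (hA j l) x) (dAt (coord_contDiff l) x), pd_coord]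

lemma pd_pp {A : Fin n → Fin n → ES n → ℝ} (hA : ∀ i j, ContDiff ℝ 1 (A i j)) (k : Fin n)
    (x : ES n) : pd k (pp A) x = ∑ l, ((if k = l then 1 else 0) * Yv A l x + x l * pd k (Yv A l) x) := by
  unfold pp
  rw [pd_sum fun l _ => dAt ((coord_contDiff l).mul (Yv_c hA l)) x]
  refine Finset.sum_congr rfl fun l _ => ?_
  rw [pd_mul (dAt (coord_contDiff l) x) (dAt (Yv_c hA l) x), pd_coord]

lemma good_bounds (n : ℕ) (M : ℝ) (hM : 0 < M) : ∃ K : ℝ, 1 ≤ K ∧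
    ∀ (κ : ℝ) (A : Fin n → Fin n → ES n → ℝ), Good κ M A → ∀ x : ES n, ‖x‖ < 3 →
      (∀ i, |Yv A i x| ≤ K) ∧ |pp A x| ≤ K ∧ |dY A x| ≤ K ∧
      |(∑ i, pd i (pp A) x * Yv A i x) + pp A x * dY A x| ≤ K ∧
      ∀ w : ES n → ℝ, |Yd A w x| ≤ K * gr w x ∧ |QQ A w x| ≤ K * gr w x ^ 2 ∧
        |KT A w x| ≤ K * gr w x ^ 2 ∧ |∑ i, pd i (pp A) x * fl A w i x| ≤ K * gr w x := by
  set N : ℝ := (n : ℝ)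
  have hN : 0 ≤ N := Nat.cast_nonneg n
  set b1 := N * (M * 3) with hb1
  set b2 := N * (M * 3 + M * 1) with hb2
  set b3 := N * (3 * b1) with hb3
  set b4 := N * (1 * b1 + 3 * b2) with hb4
  set b5 := N * b2 with hb5
  set b6 := N * (b4 * b1) + b3 * b5 with hb6
  set b7 := N * b1 with hb7
  set b8 := N * (N * M) with hb8
  set b9 := N * ((N * M) * (N * b2)) + 1 / 2 * (N * (b1 * (N * (N * M)))) with hb9
  set b10 := N * (b4 * (N * M)) with hb10
  have p1 : 0 ≤ b1 := by positivity
  have p2 : 0 ≤ b2 := by positivity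
  have p3 : 0 ≤ b3 := by positivity
  have p4 : 0 ≤ b4 := by positivity
  have p5 : 0 ≤ b5 := by positivity
  have p6 : 0 ≤ b6 := by positivity
  have p7 : 0 ≤ b7 := by positivity
  have p8 : 0 ≤ b8 := by positivity
  have p9 : 0 ≤ b9 := by positivity
  have p10 : 0 ≤ b10 := by positivity
  refine ⟨1 + b1 + b3 + b5 + b6 + b7 + b8 + b9 + b10, by linarith, ?_⟩
  intro κ A hA x hx
  have hxi : ∀ i, |x i| ≤ 3 := fun i => (abs_coord_le x i).trans hx.le
  have hδ : ∀ k l : Fin n, |(if k = l then (1:ℝ) else 0)| ≤ 1 := by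
    intro k l; split_ifs <;> simp
  have hY : ∀ i, |Yv A i x| ≤ b1 := fun i => sum_bd fun j => mul_bd (hA.bd i j x hx) (hxi j)
  have hdY : ∀ k j, |pd k (Yv A j) x| ≤ b2 := by
    intro k j
    rw [pd_Yv hA.c1]
    exact sum_bd fun l => add_bd (mul_bd (hA.dbd j l k x hx) (hxi l)) (mul_bd (hA.bd j l x hx) (hδ k l))
  have hp : |pp A x| ≤ b3 := sum_bd fun i => mul_bd (hxi i) (hY i)
  have hdp : ∀ k, |pd k (pp A) x| ≤ b4 := by
    intro k
    rw [pd_pp hA.c1]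
    exact sum_bd fun l => add_bd (mul_bd (hδ k l) (hY l)) (mul_bd (hxi l) (hdY k l))
  have hdiv : |dY A x| ≤ b5 := sum_bd fun i => hdY i i
  have h6 : |(∑ i, pd i (pp A) x * Yv A i x) + pp A x * dY A x| ≤ b6 :=
    add_bd (sum_bd fun i => mul_bd (hdp i) (hY i)) (mul_bd hp hdiv)
  refine ⟨fun i => (hY i).trans (by linarith), hp.trans (by linarith), hdiv.trans (by linarith),
    h6.trans (by linarith), ?_⟩
  intro w
  set g := gr w x
  have hg : 0 ≤ g := gr_nonneg w x
  have hw : ∀ i, |pd i w x| ≤ g := pd_le_gr w x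
  have hfl : ∀ i, |fl A w i x| ≤ N * (M * g) :=
    fun i => sum_bd fun j => mul_bd (hA.bd i j x hx) (hw j)
  have h7 : |Yd A w x| ≤ N * (b1 * g) := sum_bd fun i => mul_bd (hY i) (hw i)
  have h8 : |QQ A w x| ≤ N * (g * (N * (M * g))) := sum_bd fun i => mul_bd (hw i) (hfl i)
  have h9 : |KT A w x| ≤ N * ((N * (M * g)) * (N * (b2 * g)))
      + 1 / 2 * (N * (b1 * (N * (N * (M * g * g))))) := by
    unfold KT
    rw [sub_eq_add_neg]
    refine add_bd (sum_bd fun i => mul_bd (hfl i) (sum_bd fun j => mul_bd (hdY i j) (hw j))) ?_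
    rw [abs_neg]
    exact mul_bd (by norm_num [abs_of_pos]) (sum_bd fun i => mul_bd (hY i)
      (sum_bd fun j => sum_bd fun k => mul_bd (mul_bd (hA.dbd j k i x hx) (hw j)) (hw k)))
  have h10 : |∑ i, pd i (pp A) x * fl A w i x| ≤ N * (b4 * (N * (M * g))) :=
    sum_bd fun i => mul_bd (hdp i) (hfl i)
  have hg2 : 0 ≤ g ^ 2 := sq_nonneg g
  refine ⟨h7.trans ?_, h8.trans ?_, h9.trans ?_, h10.trans ?_⟩
  · calc N * (b1 * g) = b7 * g := by rw [hb7]; ring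
      _ ≤ _ := mul_le_mul_of_nonneg_right (by linarith) hg
  · calc _ = b8 * g ^ 2 := by rw [hb8]; ring
      _ ≤ _ := mul_le_mul_of_nonneg_right (by linarith) hg2
  · calc _ = b9 * g ^ 2 := by rw [hb9]; ring
      _ ≤ _ := mul_le_mul_of_nonneg_right (by linarith) hg2
  · calc _ = b10 * g := by rw [hb10]; ring
      _ ≤ _ := mul_le_mul_of_nonneg_right (by linarith) hg

lemma good_QQ {κ M : ℝ} {A : Fin n → Fin n → ES n → ℝ} (hA : Good κ M A) {x : ES n} (hx : ‖x‖ < 3)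
    (w : ES n → ℝ) : κ * gr w x ^ 2 ≤ QQ A w x := by
  have h := hA.ell x hx (WithLp.toLp 2 fun i => pd i w x)
  rw [EuclideanSpace.norm_sq_eq] at h
  simp only [Real.norm_eq_abs, sq_abs] at h
  rw [gr_sq]
  refine h.trans (le_of_eq ?_)
  unfold QQ fl
  refine Finset.sum_congr rfl fun i _ => ?_
  rw [Finset.mul_sum]
  exact Finset.sum_congr rfl fun j _ => by ring

lemma good_pp {κ M : ℝ} {A : Fin n → Fin n → ES n → ℝ} (hκ : 0 < κ) (hA : Good κ M A) {x : ES n}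
    (hx : ‖x‖ < 3) (hx2 : 1 / 2 ≤ ‖x‖) : κ / 4 ≤ pp A x := by
  have h := hA.ell x hx x
  have e : ∑ i, ∑ j, A i j x * x i * x j = pp A x := by
    unfold pp Yv
    refine Finset.sum_congr rfl fun i _ => ?_
    rw [Finset.mul_sum]
    exact Finset.sum_congr rfl fun j _ => by ring
  rw [e] at h
  refine le_trans ?_ h
  have : (1/4:ℝ) ≤ ‖x‖ ^ 2 := by nlinarith
  nlinarith

lemma core_scalar (κ K : ℝ) (hκ : 0 < κ) (hK : 1 ≤ K) : ∃ l : ℝ, 0 < l ∧ ∃ c : ℝ, 0 < c ∧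
    ∃ s0 : ℝ, 1 ≤ s0 ∧ ∀ s, s0 ≤ s → ∀ L w g p Q yd kt D1 D2 dy f F : ℝ,
      Real.exp (-(9 * l / 2)) ≤ f → f ≤ 1 → 0 ≤ g → κ / 4 ≤ p → |p| ≤ K → κ * g ^ 2 ≤ Q →
      |Q| ≤ K * g ^ 2 → |yd| ≤ K * g → |kt| ≤ K * g ^ 2 → |D1| ≤ K * g → |D2| ≤ K → |dy| ≤ K →
      f * (L + s ^ 2 * f ^ 2 * p * w) * (yd - l * (p * w)) - F
        = f * (l * yd * (yd - l * (p * w)) - kt + l * w * D1 + 1 / 2 * l * p * Q + 1 / 2 * dy * Q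
          + s ^ 2 * f ^ 2 * w ^ 2 * (1 / 2 * l * p ^ 2 - 1 / 2 * D2)) →
      c * (s * g ^ 2 + s ^ 3 * w ^ 2) + 4 * s * F
        ≤ (L + 2 * s * f * yd + s ^ 2 * f ^ 2 * p * w + s * f * (dy - l * p) * w) ^ 2 := by
  obtain ⟨l, hl⟩ : ∃ l, l = 32 * (K + K ^ 2 + 2) / κ ^ 2 := ⟨_, rfl⟩
  have hl0 : 0 < l := by rw [hl]; positivity
  have hlκ : l * κ ^ 2 = 32 * (K + K ^ 2 + 2) := by rw [hl]; field_simp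
  obtain ⟨f0, hf0⟩ : ∃ f0, f0 = Real.exp (-(9 * l / 2)) := ⟨_, rfl⟩
  have f0p : 0 < f0 := by rw [hf0]; exact Real.exp_pos _
  obtain ⟨B, hB⟩ : ∃ B, B = l ^ 2 * K ^ 2 + l * K := ⟨_, rfl⟩
  have hBp : 0 < B := by rw [hB]; positivity
  refine ⟨l, hl0, f0 ^ 3, by positivity, 1 + B / f0 + (l * K + K) ^ 2 / f0 ^ 3, ?_, ?_⟩
  · have : 0 ≤ B / f0 := by positivity
    have : 0 ≤ (l * K + K) ^ 2 / f0 ^ 3 := by positivity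
    linarith
  intro s hs L w g p Q yd kt D1 D2 dy f F hf hf1 hg hp hpK hQ hQK hyd hkt hD1 hD2 hdy hid
  rw [← hf0] at hf
  have q1 : 0 ≤ B / f0 := by positivity
  have q2 : 0 ≤ (l * K + K) ^ 2 / f0 ^ 3 := by positivity
  have hs1 : 1 ≤ s := by linarith
  have hsp : 0 < s := by linarith
  have hsB : B ≤ s * f0 := by
    have : B / f0 ≤ s := by linarith
    rwa [div_le_iff₀ f0p] at this
  have hsK : (l * K + K) ^ 2 ≤ s * f0 ^ 3 := by
    have : (l * K + K) ^ 2 / f0 ^ 3 ≤ s := by linarith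
    rwa [div_le_iff₀ (by positivity)] at this
  have fp : 0 < f := f0p.trans_le hf
  have f01 : f0 ≤ 1 := hf.trans hf1
  have hg2 : 0 ≤ g ^ 2 := sq_nonneg g
  have hw := abs_nonneg w
  have hw2 : |w| ^ 2 = w ^ 2 := sq_abs w
  set Z := l * yd * (yd - l * (p * w)) - kt + l * w * D1 + 1 / 2 * l * p * Q + 1 / 2 * dy * Q
          + s ^ 2 * f ^ 2 * w ^ 2 * (1 / 2 * l * p ^ 2 - 1 / 2 * D2) with hZ
  have t1 : -(l ^ 2 * (K * g * (K * |w|))) ≤ l * yd * (yd - l * (p * w)) := by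
    have h1 : |yd * (p * w)| ≤ K * g * (K * |w|) := mul_bd hyd (mul_bd hpK le_rfl)
    have h2 := (abs_le.1 h1).2
    have h3 : 0 ≤ l * yd ^ 2 := by positivity
    have h4 := mul_le_mul_of_nonneg_left h2 (sq_nonneg l)
    nlinarith only [h3, h4]
  have t2 : -(l * (|w| * (K * g))) ≤ l * w * D1 := by
    have h1 : |w * D1| ≤ |w| * (K * g) := mul_bd le_rfl hD1
    have h2 := (abs_le.1 h1).1
    have h4 := mul_le_mul_of_nonneg_left h2 hl0.le
    nlinarith only [h4]
  have t3 : 4 * (K + K ^ 2 + 2) * g ^ 2 ≤ 1 / 2 * l * p * Q := by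
    have h1 : κ / 4 * (κ * g ^ 2) ≤ p * Q :=
      mul_le_mul hp hQ (by positivity) (by linarith [hκ])
    have h2 := mul_le_mul_of_nonneg_left h1 (show 0 ≤ l / 2 by positivity)
    have h3 : l / 2 * (κ / 4 * (κ * g ^ 2)) = 4 * (K + K ^ 2 + 2) * g ^ 2 := by
      linear_combination (g ^ 2 / 8) * hlκ
    nlinarith only [h2, h3]
  have t4 : -(1 / 2 * (K * (K * g ^ 2))) ≤ 1 / 2 * dy * Q := by
    have h1 : |dy * Q| ≤ K * (K * g ^ 2) := mul_bd hdy hQK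
    linarith [(abs_le.1 h1).1]
  have t5 : 1 ≤ 1 / 2 * l * p ^ 2 - 1 / 2 * D2 := by
    have h1 : (κ / 4) ^ 2 ≤ p ^ 2 := pow_le_pow_left₀ (by positivity) hp 2
    have h2 := mul_le_mul_of_nonneg_left h1 (show 0 ≤ l / 2 by positivity)
    have h3 : l / 2 * (κ / 4) ^ 2 = K + K ^ 2 + 2 := by linear_combination (1 / 32) * hlκ
    have := (abs_le.1 hD2).2
    nlinarith only [h2, h3, this, hK]
  have t6 : s ^ 2 * f ^ 2 * w ^ 2 ≤ s ^ 2 * f ^ 2 * w ^ 2 * (1 / 2 * l * p ^ 2 - 1 / 2 * D2) :=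
    le_mul_of_one_le_right (by positivity) t5
  have t7 := (abs_le.1 hkt).2
  have hZ1 : 2 * g ^ 2 - B * (|w| * g) + s ^ 2 * f ^ 2 * w ^ 2 ≤ Z := by
    have : 0 ≤ K * g ^ 2 := by positivity
    have : 0 ≤ K ^ 2 * g ^ 2 := by positivity
    rw [hB]
    nlinarith only [t1, t2, t3, t4, t6, t7, hZ, this, hK, hg2]
  have hsf : B ^ 2 * w ^ 2 ≤ s ^ 2 * f ^ 2 * w ^ 2 := by
    have : B ≤ s * f := hsB.trans (by gcongr)
    have h2 : B ^ 2 ≤ (s * f) ^ 2 := pow_le_pow_left₀ hBp.le this 2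
    rw [← mul_pow s f 2]
    exact mul_le_mul_of_nonneg_right h2 (sq_nonneg w)
  have hsf0 : s ^ 2 * f0 ^ 2 * w ^ 2 ≤ s ^ 2 * f ^ 2 * w ^ 2 := by gcongr
  have hZ2 : g ^ 2 + 1 / 2 * (s ^ 2 * f0 ^ 2 * w ^ 2) ≤ Z := by
    have h1 : B * (|w| * g) ≤ g ^ 2 + 1 / 4 * (B ^ 2 * w ^ 2) := by
      nlinarith only [sq_nonneg (g - B * |w| / 2), hw2]
    have : 0 ≤ s ^ 2 * f ^ 2 * w ^ 2 := by positivity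
    linarith
  have hfZ : f0 * (g ^ 2 + 1 / 2 * (s ^ 2 * f0 ^ 2 * w ^ 2)) ≤ f * Z :=
    mul_le_mul hf hZ2 (by positivity) fp.le
  set S := L + s ^ 2 * f ^ 2 * p * w with hS
  set m := yd - l * (p * w) with hm
  have hP : L + 2 * s * f * yd + s ^ 2 * f ^ 2 * p * w + s * f * (dy - l * p) * w
      = (S + 2 * s * f * m) + s * f * (l * p + dy) * w := by rw [hS, hm]; ring
  have hR : (s * f * (l * p + dy) * w) ^ 2 ≤ s ^ 2 * (l * K + K) ^ 2 * w ^ 2 := by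
    have h1 : |f * (l * p + dy)| ≤ 1 * (l * K + K) :=
      mul_bd (by rw [abs_of_pos fp]; exact hf1)
        (add_bd (mul_bd (le_of_eq (abs_of_pos hl0)) hpK) hdy)
    have h2 : (f * (l * p + dy)) ^ 2 ≤ (l * K + K) ^ 2 := by
      rw [one_mul] at h1
      exact sq_le_sq.2 (h1.trans (le_abs_self _))
    have h3 := mul_le_mul_of_nonneg_left h2 (show 0 ≤ s ^ 2 * w ^ 2 by positivity)
    nlinarith only [h3]
  have hR2 : s ^ 2 * (l * K + K) ^ 2 * w ^ 2 ≤ s ^ 3 * f0 ^ 3 * w ^ 2 := by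
    have h3 := mul_le_mul_of_nonneg_left hsK (show 0 ≤ s ^ 2 * w ^ 2 by positivity)
    nlinarith only [h3]
  have hsq : 4 * s * (f * S * m) - (s * f * (l * p + dy) * w) ^ 2
      ≤ ((S + 2 * s * f * m) + s * f * (l * p + dy) * w) ^ 2 := by
    nlinarith only [sq_nonneg (S - 2 * s * f * m),
      sq_nonneg ((S + 2 * s * f * m) + 2 * (s * f * (l * p + dy) * w))]
  rw [hP]
  refine le_trans ?_ hsq
  have h5 : 4 * s * (f * S * m) = 4 * s * F + 4 * s * (f * Z) := by linear_combination 4 * s * hid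
  have h6 := mul_le_mul_of_nonneg_left hfZ (show 0 ≤ 4 * s by positivity)
  have h7 : f0 ^ 3 * (s * g ^ 2) ≤ f0 * (s * g ^ 2) := by
    apply mul_le_mul_of_nonneg_right _ (by positivity)
    calc f0 ^ 3 ≤ f0 ^ 1 := pow_le_pow_of_le_one f0p.le f01 (by norm_num)
      _ = f0 := pow_one _
  have h8 : 0 ≤ f0 * (s * g ^ 2) := by positivity
  nlinarith only [h5, h6, h7, h8, hR, hR2]

end Bounds

section Carl
variable {n : ℕ}

lemma ph_eq (l : ℝ) (x : ES n) : ph l x = Real.exp (-(l / 2) * ‖x‖ ^ 2) := by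
  unfold ph
  rw [EuclideanSpace.norm_sq_eq]
  simp [pow_two]

/-- The exponential Carleman weight. -/
def Ex (l s : ℝ) (x : ES n) : ℝ := Real.exp (s / l * ph l x)

lemma Ex_pos (l s : ℝ) (x : ES n) : 0 < Ex l s x := Real.exp_pos _

lemma Ex_c {k : WithTop ℕ∞} (l s : ℝ) : ContDiff ℝ k (Ex l s : ES n → ℝ) := by
  unfold Ex
  exact ContDiff.exp (contDiff_const.mul (ph_c l))

lemma pd_Ex {l : ℝ} (hl : 0 < l) (s : ℝ) (i : Fin n) (x : ES n) :
    pd i (Ex l s) x = -s * (ph l x * x i * Ex l s x) := by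
  have h1 : DifferentiableAt ℝ (ph l : ES n → ℝ) x := dAt (ph_c l) x
  have : pd i (Ex l s) x = Ex l s x * pd i (fun y : ES n => s / l * ph l y) x :=
    pd_exp (h1.const_mul _)
  rw [this, pd_const_mul _ h1, pd_ph]
  field_simp

variable {A : Fin n → Fin n → ES n → ℝ}

lemma fl_mul {f g : ES n → ℝ} (hf : ContDiff ℝ 2 f) (hg : ContDiff ℝ 2 g) (i : Fin n) (x : ES n) :
    fl A (fun y => f y * g y) i x = f x * fl A g i x + g x * fl A f i x := by
  have hf1 : ContDiff ℝ 1 f := hf.of_le (by norm_num)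
  have hg1 : ContDiff ℝ 1 g := hg.of_le (by norm_num)
  unfold fl
  rw [Finset.mul_sum, Finset.mul_sum, ← Finset.sum_add_distrib]
  refine Finset.sum_congr rfl fun j _ => ?_
  rw [pd_mul (dAt hf1 x) (dAt hg1 x)]; ring

lemma fl_symm {f g : ES n → ℝ} (hs : ∀ i j x, A i j x = A j i x) (x : ES n) :
    ∑ i, pd i f x * fl A g i x = ∑ i, pd i g x * fl A f i x := by
  unfold fl
  simp_rw [Finset.mul_sum]
  rw [Finset.sum_comm]
  refine Finset.sum_congr rfl fun a _ => Finset.sum_congr rfl fun b _ => ?_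
  rw [hs b a]; ring

lemma Lop_mul {f g : ES n → ℝ} (hA : ∀ i j, ContDiff ℝ 1 (A i j)) (hs : ∀ i j x, A i j x = A j i x)
    (hf : ContDiff ℝ 2 f) (hg : ContDiff ℝ 2 g) (x : ES n) :
    Lop A (fun y => f y * g y) x
      = f x * Lop A g x + 2 * (∑ i, pd i f x * fl A g i x) + g x * Lop A f x := by
  have hf1 : ContDiff ℝ 1 f := hf.of_le (by norm_num)
  have hg1 : ContDiff ℝ 1 g := hg.of_le (by norm_num)
  have h : ∀ i, pd i (fl A (fun y => f y * g y) i) x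
      = (pd i f x * fl A g i x + f x * pd i (fl A g i) x)
        + (pd i g x * fl A f i x + g x * pd i (fl A f i) x) := by
    intro i
    have e : fl A (fun y => f y * g y) i = fun y => f y * fl A g i y + g y * fl A f i y :=
      funext fun y => fl_mul hf hg i y
    rw [e, pd_add (dAt (hf1.mul (fl_c hA hg i)) x) (dAt (hg1.mul (fl_c hA hf i)) x),
      pd_mul (dAt hf1 x) (dAt (fl_c hA hg i) x), pd_mul (dAt hg1 x) (dAt (fl_c hA hf i) x)]
  have h2 := fl_symm (f := f) (g := g) hs x
  unfold Lop
  simp_rw [h, Finset.sum_add_distrib, ← Finset.mul_sum]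
  rw [← h2]; ring

lemma Lop_Ex {l : ℝ} (hl : 0 < l) (s : ℝ) (hA : ∀ i j, ContDiff ℝ 1 (A i j)) (x : ES n) :
    Lop A (Ex l s) x = Ex l s x * (-s * ph l x * dY A x + s * l * ph l x * pp A x
      + s ^ 2 * ph l x ^ 2 * pp A x) := by
  have e : ∀ i, fl A (Ex l s) i = fun y => -s * (ph l y * (Ex l s y * Yv A i y)) := by
    intro i; funext y
    unfold fl Yv
    simp_rw [pd_Ex hl, Finset.mul_sum]
    exact Finset.sum_congr rfl fun j _ => by ring
  have c1 : ContDiff ℝ 1 (ph l : ES n → ℝ) := ph_c l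
  have c2 : ContDiff ℝ 1 (Ex l s : ES n → ℝ) := Ex_c l s
  have h : ∀ i, pd i (fl A (Ex l s) i) x = s * l * ph l x * Ex l s x * (x i * Yv A i x)
      + s ^ 2 * ph l x ^ 2 * Ex l s x * (x i * Yv A i x)
      + (-s * ph l x * Ex l s x) * pd i (Yv A i) x := by
    intro i
    have c3 := Yv_c hA i
    rw [e, pd_const_mul _ (dAt (c1.mul (c2.mul c3)) x), pd_mul (dAt c1 x) (dAt (c2.mul c3) x),
      pd_mul (dAt c2 x) (dAt c3 x), pd_ph, pd_Ex hl]
    ring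
  unfold Lop
  simp_rw [h, Finset.sum_add_distrib, ← Finset.mul_sum]
  have e1 : ∑ i, x i * Yv A i x = pp A x := rfl
  have e4 : ∑ i, pd i (Yv A i) x = dY A x := rfl
  rw [e1, e4]; ring

lemma pd_Exmul {l : ℝ} (hl : 0 < l) (s : ℝ) {u : ES n → ℝ} (hu : ContDiff ℝ 2 u) (i : Fin n) (x : ES n) :
    pd i (fun y => Ex l s y * u y) x = Ex l s x * pd i u x - s * ph l x * x i * (Ex l s x * u x) := by
  rw [pd_mul (dAt (Ex_c l s) x) (dAt (hu.of_le (by norm_num)) x), pd_Ex hl]; ring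

lemma conj_id {l : ℝ} (hl : 0 < l) (s : ℝ) (hA : ∀ i j, ContDiff ℝ 1 (A i j))
    (hs : ∀ i j x, A i j x = A j i x) {u : ES n → ℝ} (hu : ContDiff ℝ 2 u) (x : ES n) :
    Lop A (fun y => Ex l s y * u y) x + 2 * s * ph l x * Yd A (fun y => Ex l s y * u y) x
      + s ^ 2 * ph l x ^ 2 * pp A x * (Ex l s x * u x)
      + s * ph l x * (dY A x - l * pp A x) * (Ex l s x * u x) = Ex l s x * Lop A u x := by
  have h1 : ∑ i, pd i (Ex l s) x * fl A u i x = -s * ph l x * Ex l s x * Yd A u x := by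
    rw [← sum_x_fl hs, Finset.mul_sum]
    refine Finset.sum_congr rfl fun i _ => ?_
    rw [pd_Ex hl]; ring
  have h2 : Yd A (fun y => Ex l s y * u y) x
      = Ex l s x * Yd A u x - s * ph l x * (Ex l s x * u x) * pp A x := by
    unfold Yd pp
    rw [Finset.mul_sum, Finset.mul_sum, ← Finset.sum_sub_distrib]
    refine Finset.sum_congr rfl fun i _ => ?_
    rw [pd_Exmul hl s hu]; ring
  rw [Lop_mul hA hs (Ex_c l s) hu, h1, h2, Lop_Ex hl s hA]
  ring

lemma gr_conv {l : ℝ} (hl : 0 < l) {s : ℝ} (hs : 1 ≤ s) {u : ES n → ℝ} (hu : ContDiff ℝ 2 u)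
    {x : ES n} (hx : ‖x‖ < 3) :
    Ex l s x ^ 2 * (s * gr u x ^ 2 + s ^ 3 * u x ^ 2) ≤
      19 * (s * gr (fun y => Ex l s y * u y) x ^ 2 + s ^ 3 * (Ex l s x * u x) ^ 2) := by
  set w := fun y => Ex l s y * u y with hw
  have hph1 : ph l x ≤ 1 := by
    rw [ph_eq]; apply Real.exp_le_one_iff.2
    have : 0 ≤ l / 2 * ‖x‖ ^ 2 := by positivity
    linarith
  have hph0 := ph_pos l x
  have h1 : Ex l s x ^ 2 * gr u x ^ 2 ≤ 2 * gr w x ^ 2 + 18 * (s ^ 2 * (Ex l s x * u x) ^ 2) := by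
    have e1 : Ex l s x ^ 2 * gr u x ^ 2
        = ∑ i, (pd i w x + s * ph l x * x i * (Ex l s x * u x)) ^ 2 := by
      rw [gr_sq, Finset.mul_sum]
      refine Finset.sum_congr rfl fun i _ => ?_
      rw [hw, pd_Exmul hl s hu]; ring
    have e2 : ∑ i, (pd i w x + s * ph l x * x i * (Ex l s x * u x)) ^ 2
        ≤ ∑ i, (2 * (pd i w x) ^ 2 + 2 * (s * ph l x * (Ex l s x * u x)) ^ 2 * (x i) ^ 2) := by
      refine Finset.sum_le_sum fun i _ => ?_
      nlinarith only [sq_nonneg (pd i w x - s * ph l x * x i * (Ex l s x * u x))]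
    rw [e1]
    refine e2.trans ?_
    rw [Finset.sum_add_distrib, ← Finset.mul_sum, ← Finset.mul_sum, ← gr_sq]
    have e3 : ∑ i, (x i) ^ 2 = ‖x‖ ^ 2 := by rw [EuclideanSpace.norm_sq_eq]; simp
    rw [e3]
    have e4 : ph l x ^ 2 * ‖x‖ ^ 2 ≤ 9 := by
      have a1 : ph l x ^ 2 ≤ 1 := pow_le_one₀ hph0.le hph1
      have a2 : ‖x‖ ^ 2 ≤ 9 := by nlinarith [norm_nonneg x]
      nlinarith [sq_nonneg ‖x‖, sq_nonneg (ph l x)]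
    have e5 := mul_le_mul_of_nonneg_left e4 (show 0 ≤ 2 * (s ^ 2 * (Ex l s x * u x) ^ 2) by positivity)
    nlinarith only [e5]
  have h2 := mul_le_mul_of_nonneg_left h1 (show 0 ≤ s by linarith)
  have h3 : 0 ≤ s * gr w x ^ 2 := by positivity
  nlinarith only [h2, h3]

lemma zero_near {u : ES n → ℝ} {x : ES n} (hx : x ∉ tsupport u) :
    ∀ᶠ y in nhds x, u y = 0 ∧ ∀ i, pd i u y = 0 := by
  have h : u =ᶠ[nhds x] 0 := notMem_tsupport_iff_eventuallyEq.1 hx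
  have h2 := h.eventuallyEq_nhds
  filter_upwards [h, h2] with y h3 h4
  refine ⟨h3, fun i => ?_⟩
  rw [pd_congr h4]
  simp [pd]

lemma fl_zero {u : ES n → ℝ} {y : ES n} (h : ∀ i, pd i u y = 0) (i : Fin n) : fl A u i y = 0 := by
  simp [fl, h]

lemma pd_zero_of {f : ES n → ℝ} {x : ES n} (h : ∀ᶠ y in nhds x, f y = 0) (i : Fin n) :
    pd i f x = 0 := by
  rw [pd_congr (g := fun _ => 0) h]
  simp [pd]

lemma Lop_zero {u : ES n → ℝ} {x : ES n} (hx : x ∉ tsupport u) : Lop A u x = 0 := by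
  refine Finset.sum_eq_zero fun i _ => pd_zero_of ?_ i
  filter_upwards [zero_near hx] with y hy
  exact fl_zero hy.2 i

lemma gr_zero {u : ES n → ℝ} {x : ES n} (hx : x ∉ tsupport u) : gr u x = 0 := by
  have h := (zero_near hx).self_of_nhds.2
  simp [gr, h]

lemma FF_zero {l s : ℝ} {w : ES n → ℝ} {y : ES n} (h0 : w y = 0) (h : ∀ i, pd i w y = 0) (i : Fin n) :
    FF l s A w i y = 0 := by
  have hQ : QQ A w y = 0 := by simp [QQ, h]
  simp [FF, fl_zero h, hQ, h0]

lemma Lop_cont {u : ES n → ℝ} (hA : ∀ i j, ContDiff ℝ 1 (A i j)) (hu : ContDiff ℝ 2 u) :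
    Continuous (Lop A u) := by
  unfold Lop
  exact continuous_finset_sum _ fun i _ => pd_continuous (fl_c hA hu i) i

lemma gr_cont {u : ES n → ℝ} (hu : ContDiff ℝ 1 u) : Continuous (gr u) := by
  unfold gr
  exact (continuous_finset_sum _ fun i _ => (pd_continuous hu i).pow 2).sqrt

theorem carleman (n : ℕ) (κ M : ℝ) (hκ : 0 < κ) (hM : 0 < M) :
    ∃ l : ℝ, 0 < l ∧ ∃ c : ℝ, 0 < c ∧ ∃ s0 : ℝ, 1 ≤ s0 ∧ ∀ s, s0 ≤ s →
      ∀ A : Fin n → Fin n → ES n → ℝ, Good κ M A → ∀ u : ES n → ℝ, ContDiff ℝ 2 u →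
        HasCompactSupport u → (∀ x ∈ tsupport u, 1 / 2 ≤ ‖x‖ ∧ ‖x‖ < 3) →
        c * s * ∫ x, Ex l s x ^ 2 * (u x ^ 2 + gr u x ^ 2)
          ≤ ∫ x, Ex l s x ^ 2 * Lop A u x ^ 2 := by
  obtain ⟨K, hK, hbd⟩ := good_bounds n M hM
  obtain ⟨l, hl, c, hc, s0, hs0, hcore⟩ := core_scalar κ K hκ hK
  refine ⟨l, hl, c / 19, by positivity, s0, hs0, ?_⟩
  intro s hs A hA u hu huc hsupp
  have hs1 : 1 ≤ s := hs0.trans hs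
  set w := fun y => Ex l s y * u y with hw
  have hw2 : ContDiff ℝ 2 w := (Ex_c l s).mul hu
  have htw : tsupport w ⊆ tsupport u := closure_mono (by
    intro x hx; simp only [hw, Function.mem_support] at hx ⊢
    exact fun h => hx (by rw [h, mul_zero]))
  have hpt : ∀ x, c / 19 * s * (Ex l s x ^ 2 * (u x ^ 2 + gr u x ^ 2))
      + 4 * s * ∑ i, pd i (FF l s A w i) x ≤ Ex l s x ^ 2 * Lop A u x ^ 2 := by
    intro x
    by_cases hx : x ∈ tsupport u
    · obtain ⟨hx1, hx2⟩ := hsupp x hx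
      obtain ⟨-, b1, b2, b3, b4⟩ := hbd κ A hA x hx2
      obtain ⟨b5, b6, b7, b8⟩ := b4 w
      have hx9 : ‖x‖ ^ 2 ≤ 9 := by nlinarith [norm_nonneg x]
      have h := hcore s hs (Lop A w x) (w x) (gr w x) (pp A x) (QQ A w x) (Yd A w x) (KT A w x)
        (∑ i, pd i (pp A) x * fl A w i x) ((∑ i, pd i (pp A) x * Yv A i x) + pp A x * dY A x)
        (dY A x) (ph l x) (∑ i, pd i (FF l s A w i) x)
        (by rw [ph_eq]; apply Real.exp_le_exp.2; nlinarith)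
        (by rw [ph_eq]; apply Real.exp_le_one_iff.2; nlinarith [sq_nonneg ‖x‖])
        (gr_nonneg w x) (good_pp hκ hA hx2 hx1) b1 (good_QQ hA hx2 w) b6 b5 b7 b8 b3 b2
        (div_FF l s hA.c1 hA.symm hw2 x)
      have h2 := conj_id hl s hA.c1 hA.symm hu x
      have h2' : Lop A w x + 2 * s * ph l x * Yd A w x + s ^ 2 * ph l x ^ 2 * pp A x * w x
        + s * ph l x * (dY A x - l * pp A x) * w x = Ex l s x * Lop A u x := h2
      rw [h2', mul_pow (Ex l s x) (Lop A u x)] at h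
      refine le_trans ?_ h
      have h3 := gr_conv hl hs1 hu hx2
      have h4 : s * (u x ^ 2 + gr u x ^ 2) ≤ s * gr u x ^ 2 + s ^ 3 * u x ^ 2 := by
        have : s ^ 1 ≤ s ^ 3 := pow_le_pow_right₀ hs1 (by norm_num)
        nlinarith [sq_nonneg (u x)]
      have h5 := mul_le_mul_of_nonneg_left h4 (sq_nonneg (Ex l s x))
      have h6 := mul_le_mul_of_nonneg_left (h5.trans h3) (show 0 ≤ c / 19 by positivity)
      have hwx : w x = Ex l s x * u x := rfl
      rw [hwx]
      nlinarith only [h6]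
    · have hx' : x ∉ tsupport w := fun h => hx (htw h)
      have hF : ∀ i, pd i (FF l s A w i) x = 0 := by
        intro i
        apply pd_zero_of
        filter_upwards [zero_near hx'] with y hy
        exact FF_zero hy.1 hy.2 i
      rw [Lop_zero hx, gr_zero hx, (zero_near hx).self_of_nhds.1]
      simp [hF]
  have hcE : Continuous (Ex l s : ES n → ℝ) := (Ex_c (k := 1) l s).continuous
  have hcu : Continuous u := hu.continuous
  have i1 : Integrable fun x => Ex l s x ^ 2 * (u x ^ 2 + gr u x ^ 2) := by
    refine Continuous.integrable_of_hasCompactSupport ?_ (HasCompactSupport.intro huc fun x hx => ?_)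
    · have := gr_cont (hu.of_le (m := 1) (by norm_num))
      fun_prop
    · rw [gr_zero hx, (zero_near hx).self_of_nhds.1]; simp
  have i2 : Integrable fun x => Ex l s x ^ 2 * Lop A u x ^ 2 := by
    refine Continuous.integrable_of_hasCompactSupport ?_ (HasCompactSupport.intro huc fun x hx => ?_)
    · have := Lop_cont hA.c1 hu
      fun_prop
    · rw [Lop_zero hx]; simp
  have cF : ∀ i, ContDiff ℝ 1 (FF l s A w i) := fun i => FF_c l s hA.c1 hw2 i
  have sF : ∀ i, HasCompactSupport (FF l s A w i) := fun i =>
    HasCompactSupport.intro huc fun x hx => by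
      have := (zero_near (fun h => hx (htw h))).self_of_nhds
      exact FF_zero this.1 this.2 i
  have i3 : ∀ i, Integrable fun x => pd i (FF l s A w i) x := fun i =>
    (pd_continuous (cF i) i).integrable_of_hasCompactSupport (pd_compact (sF i) i)
  have i4 : Integrable fun x => ∑ i, pd i (FF l s A w i) x := integrable_finset_sum _ fun i _ => i3 i
  have z : ∫ x, ∑ i, pd i (FF l s A w i) x = 0 := by
    rw [integral_finset_sum _ fun i _ => i3 i]
    exact Finset.sum_eq_zero fun i _ => integral_pd_zero (cF i) (sF i) i
  have h := integral_mono ((i1.const_mul (c / 19 * s)).add (i4.const_mul (4 * s))) i2 hpt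
  simp only [Pi.add_apply] at h
  rw [integral_add (i1.const_mul _) (i4.const_mul _), integral_const_mul, integral_const_mul, z] at h
  linarith

end Carl

section Three
variable {n : ℕ}

lemma interp (a b C s0 : ℝ) (ha : 0 < a) (hb : 0 < b) (hC : 0 < C) :
    ∀ N1 N2 N3 : ℝ, 0 ≤ N1 → 0 ≤ N2 → N2 ≤ N3 →
      (∀ s, s0 ≤ s → N2 ≤ C * (Real.exp (a * s) * N1 + Real.exp (-(b * s)) * N3)) →
      N2 ≤ (2 * C + Real.exp (b * s0)) * (N1 ^ (b / (a + b)) * N3 ^ (1 - b / (a + b))) := by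
  intro N1 N2 N3 h1 h2 h23 H
  set t := b / (a + b) with ht
  have hab : 0 < a + b := by positivity
  have ht0 : 0 < t := by positivity
  have ht1 : 1 - t = a / (a + b) := by rw [ht]; field_simp; ring
  have h3 : 0 ≤ N3 := h2.trans h23
  have hR : 0 ≤ N1 ^ t * N3 ^ (1 - t) := mul_nonneg (Real.rpow_nonneg h1 _) (Real.rpow_nonneg h3 _)
  rcases h1.eq_or_lt with h0 | h0
  · have hz : N2 ≤ 0 := by
      have hlim : Filter.Tendsto (fun s => C * (Real.exp (a * s) * N1 + Real.exp (-(b * s)) * N3))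
          Filter.atTop (nhds (C * (0 + 0 * N3))) := by
        rw [← h0]
        simp only [mul_zero]
        refine Filter.Tendsto.const_mul _ (Filter.Tendsto.add tendsto_const_nhds
          (Filter.Tendsto.mul_const _ ?_))
        exact Real.tendsto_exp_neg_atTop_nhds_zero.comp (Filter.tendsto_id.const_mul_atTop hb)
      have := ge_of_tendsto hlim (Filter.eventually_atTop.2 ⟨s0, fun s hs => H s hs⟩)
      simpa using this
    have : 0 ≤ (2 * C + Real.exp (b * s0)) * (N1 ^ t * N3 ^ (1 - t)) := by positivity
    linarith
  · by_cases hc : Real.exp ((a + b) * s0) * N1 ≤ N3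
    · have h3p : 0 < N3 := lt_of_lt_of_le (by positivity) hc
      set q := Real.log N3 - Real.log N1 with hq
      have hs : s0 ≤ q / (a + b) := by
        rw [le_div_iff₀ hab]
        have := Real.log_le_log (by positivity) hc
        rw [Real.log_mul (Real.exp_pos _).ne' h0.ne', Real.log_exp] at this
        linarith
      have h := H _ hs
      have e0 : N1 ^ t * N3 ^ (1 - t) = Real.exp (t * Real.log N1 + (1 - t) * Real.log N3) := by
        rw [Real.exp_add, Real.rpow_def_of_pos h0, Real.rpow_def_of_pos h3p]
        ring_nf
      have e1 : Real.exp (a * (q / (a + b))) * N1 = N1 ^ t * N3 ^ (1 - t) := by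
        rw [e0]
        nth_rewrite 1 [← Real.exp_log h0]
        rw [← Real.exp_add]
        congr 1
        rw [ht, hq]; field_simp; ring
      have e2 : Real.exp (-(b * (q / (a + b)))) * N3 = N1 ^ t * N3 ^ (1 - t) := by
        rw [e0]
        nth_rewrite 1 [← Real.exp_log h3p]
        rw [← Real.exp_add]
        congr 1
        rw [ht, hq]; field_simp; ring
      rw [e1, e2] at h
      have := mul_nonneg (Real.exp_pos (b * s0)).le hR
      linarith
    · push Not at hc
      have e1 : N3 = N3 ^ t * N3 ^ (1 - t) := by
        rw [← Real.rpow_add' h3 (by norm_num)]; simp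
      have e2 : N3 ^ t ≤ Real.exp (b * s0) * N1 ^ t := by
        calc N3 ^ t ≤ (Real.exp ((a + b) * s0) * N1) ^ t := Real.rpow_le_rpow h3 hc.le ht0.le
          _ = _ := by
            rw [Real.mul_rpow (Real.exp_pos _).le h1, ← Real.exp_mul]
            congr 2
            rw [ht]; field_simp
      have e3 := mul_le_mul_of_nonneg_right e2 (Real.rpow_nonneg h3 (1 - t))
      rw [← e1] at e3
      have := mul_nonneg hC.le hR
      nlinarith only [e3, this, h23]

lemma cutoff (n : ℕ) : ∃ η : ES n → ℝ, ContDiff ℝ 2 η ∧ HasCompactSupport η ∧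
    (∀ x ∈ tsupport η, 1 / 2 ≤ ‖x‖ ∧ ‖x‖ < 3) ∧
    (∀ x, 3 / 4 < ‖x‖ → ‖x‖ < 11 / 4 → η x = 1) ∧
    ∃ H : ℝ, 0 < H ∧ ∀ x, |η x| ≤ H ∧ (∀ i, |pd i η x| ≤ H) ∧ ∀ i j, |pd i (pd j η) x| ≤ H := by
  let f1 : ContDiffBump (0 : ES n) := ⟨11 / 4, 23 / 8, by norm_num, by norm_num⟩
  let f2 : ContDiffBump (0 : ES n) := ⟨1 / 2, 3 / 4, by norm_num, by norm_num⟩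
  let η : ES n → ℝ := fun x => f1 x * (1 - f2 x)
  have hη : ContDiff ℝ 2 η := f1.contDiff.mul (contDiff_const.sub f2.contDiff)
  have hc : HasCompactSupport η := f1.hasCompactSupport.mul_right
  have hb : ∀ f : ES n → ℝ, Continuous f → HasCompactSupport f → ∃ B, 0 ≤ B ∧ ∀ x, |f x| ≤ B := by
    intro f hf hfc
    obtain ⟨B, hB⟩ := hf.bounded_above_of_compact_support hfc
    exact ⟨|B|, abs_nonneg _, fun x => (hB x).trans (le_abs_self _)⟩
  refine ⟨η, hη, hc, ?_, ?_, ?_⟩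
  · intro x hx
    constructor
    · have hcl : IsClosed {x : ES n | 1 / 2 ≤ ‖x‖} := isClosed_le continuous_const continuous_norm
      refine closure_minimal ?_ hcl hx
      intro y hy
      by_contra hlt
      simp only [mem_setOf_eq, not_le] at hlt
      apply hy
      have : f2 y = 1 := f2.one_of_mem_closedBall (by simpa [f2] using hlt.le)
      simp [η, this]
    · have hx1 : x ∈ tsupport f1 := closure_mono (by
        intro y hy; simp only [η, Function.mem_support] at hy ⊢
        exact left_ne_zero_of_mul hy) hx
      rw [f1.tsupport_eq] at hx1
      have : ‖x‖ ≤ 23 / 8 := by simpa [f1] using hx1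
      linarith
  · intro x h1 h2
    have e1 : f1 x = 1 := f1.one_of_mem_closedBall (by simpa [f1] using h2.le)
    have e2 : f2 x = 0 := f2.zero_of_le_dist (by simpa [f2] using h1.le)
    simp [η, e1, e2]
  · obtain ⟨B0, p0, hB0⟩ := hb η hη.continuous hc
    have hη1 : ContDiff ℝ 1 η := hη.of_le (by norm_num)
    choose B1 p1 hB1 using fun i => hb (pd i η) (pd_continuous hη1 i) (pd_compact hc i)
    choose B2 p2 hB2 using fun i j => hb (pd i (pd j η)) (pd_continuous (pd_contDiff hη j) i)
      (pd_compact (pd_compact hc j) i)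
    have s1 : ∀ i, B1 i ≤ ∑ i, B1 i := fun i =>
      Finset.single_le_sum (fun i _ => p1 i) (Finset.mem_univ i)
    have s1' : 0 ≤ ∑ i, B1 i := Finset.sum_nonneg fun i _ => p1 i
    have s2'' : ∀ i, 0 ≤ ∑ j, B2 i j := fun i => Finset.sum_nonneg fun j _ => p2 i j
    have s2 : ∀ i j, B2 i j ≤ ∑ i, ∑ j, B2 i j := fun i j =>
      (Finset.single_le_sum (f := fun j => B2 i j) (fun j _ => p2 i j) (Finset.mem_univ j)).trans
      (Finset.single_le_sum (f := fun i => ∑ j, B2 i j) (fun i _ => s2'' i) (Finset.mem_univ i))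
    have s2' : 0 ≤ ∑ i, ∑ j, B2 i j := Finset.sum_nonneg fun i _ => s2'' i
    refine ⟨1 + B0 + ∑ i, B1 i + ∑ i, ∑ j, B2 i j, by positivity, fun x => ⟨?_, ?_, ?_⟩⟩
    · linarith [hB0 x]
    · intro i; linarith [hB1 i x, s1 i]
    · intro i j; linarith [hB2 i j x, s2 i j]

/-- The `H¹` density. -/
def hd (v : ES n → ℝ) (x : ES n) : ℝ := v x ^ 2 + gr v x ^ 2

lemma hd_nonneg (v : ES n → ℝ) (x : ES n) : 0 ≤ hd v x := by unfold hd; positivity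

lemma Lop_cut {κ M M1 H : ℝ} (hM : 0 < M) (hH : 0 < H) {A : Fin n → Fin n → ES n → ℝ} (hA : Good κ M A)
    {η v : ES n → ℝ} (hη : ContDiff ℝ 2 η) (hv : ContDiff ℝ 2 v) {x : ES n} (hx : ‖x‖ < 3)
    (hb : |η x| ≤ H ∧ (∀ i, |pd i η x| ≤ H) ∧ ∀ i j, |pd i (pd j η) x| ≤ H)
    (hL : Lop A v x ^ 2 ≤ M1 * hd v x) :
    Lop A (fun y => η y * v y) x ^ 2 ≤
      3 * (H ^ 2 * M1 + (2 * (n * (H * (n * M)))) ^ 2 + (n * (n * (M * H + M * H))) ^ 2) * hd v x := by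
  obtain ⟨h0, h1, h2⟩ := hb
  rw [Lop_mul hA.c1 hA.symm hη hv]
  set g := gr v x with hg
  have hg0 : 0 ≤ g := gr_nonneg v x
  have e1 : |∑ i, pd i η x * fl A v i x| ≤ n * (H * (n * (M * g))) :=
    sum_bd fun i => mul_bd (h1 i) (sum_bd fun j => mul_bd (hA.bd i j x hx) (pd_le_gr v x j))
  have e2 : |Lop A η x| ≤ n * (n * (M * H + M * H)) := by
    unfold Lop
    refine sum_bd fun i => ?_
    rw [pd_fl hA.c1 hη]
    exact sum_bd fun k => add_bd (mul_bd (hA.dbd i k i x hx) (h1 k)) (mul_bd (hA.bd i k x hx) (h2 i k))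
  have a1 : (η x * Lop A v x) ^ 2 ≤ H ^ 2 * (M1 * hd v x) := by
    rw [mul_pow]
    exact mul_le_mul (sq_le_sq.2 (h0.trans (le_abs_self H))) hL (sq_nonneg _) (sq_nonneg _)
  have a2 : (2 * ∑ i, pd i η x * fl A v i x) ^ 2 ≤ (2 * (n * (H * (n * M)))) ^ 2 * g ^ 2 := by
    rw [← mul_pow]
    apply sq_le_sq.2
    rw [abs_mul, abs_of_pos (two_pos : (0:ℝ) < 2)]
    refine le_trans ?_ (le_abs_self _)
    linarith
  have a3 : (v x * Lop A η x) ^ 2 ≤ (n * (n * (M * H + M * H))) ^ 2 * v x ^ 2 := by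
    rw [mul_pow, mul_comm]
    exact mul_le_mul_of_nonneg_right (sq_le_sq.2 (e2.trans (le_abs_self _))) (sq_nonneg _)
  have c1 : (2 * (n * (H * (n * M)))) ^ 2 * g ^ 2 ≤ (2 * (n * (H * (n * M)))) ^ 2 * hd v x :=
    mul_le_mul_of_nonneg_left (by unfold hd; nlinarith [sq_nonneg (v x)]) (sq_nonneg _)
  have c2 : (n * (n * (M * H + M * H))) ^ 2 * v x ^ 2 ≤ (n * (n * (M * H + M * H))) ^ 2 * hd v x :=
    mul_le_mul_of_nonneg_left (by unfold hd; nlinarith [sq_nonneg g]) (sq_nonneg _)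
  generalize η x * Lop A v x = X at *
  generalize 2 * ∑ i, pd i η x * fl A v i x = Y at *
  generalize v x * Lop A η x = Z at *
  have h3 : (X + Y + Z) ^ 2 ≤ 3 * (X ^ 2 + Y ^ 2 + Z ^ 2) := by
    nlinarith only [sq_nonneg (X - Y), sq_nonneg (Y - Z), sq_nonneg (X - Z)]
  linarith

end Three

section Norm3
variable {n : ℕ}

lemma hd_cont {u : ES n → ℝ} (hu : ContDiff ℝ 2 u) : Continuous (hd u) := by
  unfold hd
  exact (hu.continuous.pow 2).add ((gr_cont (hu.of_le (by norm_num))).pow 2)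

lemma hd_intOn {u : ES n → ℝ} (hu : ContDiff ℝ 2 u) (R : ℝ) : IntegrableOn (hd u) (ball 0 R) :=
  ((hd_cont hu).continuousOn.integrableOn_compact (isCompact_closedBall 0 R)).mono_set
    ball_subset_closedBall

lemma Ex_le {l s R : ℝ} (hl : 0 < l) (hs : 0 < s) (hR : 0 ≤ R) {x : ES n} (hx : R ≤ ‖x‖) :
    Ex l s x ^ 2 ≤ Real.exp (2 / l * Real.exp (-(l / 2) * R ^ 2) * s) := by
  unfold Ex
  rw [← Real.exp_nat_mul, ph_eq]
  apply Real.exp_le_exp.2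
  have h1 : Real.exp (-(l / 2) * ‖x‖ ^ 2) ≤ Real.exp (-(l / 2) * R ^ 2) := by
    apply Real.exp_le_exp.2
    have : R ^ 2 ≤ ‖x‖ ^ 2 := pow_le_pow_left₀ hR hx 2
    nlinarith
  have h2 : 0 ≤ 2 * (s / l) := by positivity
  have := mul_le_mul_of_nonneg_left h1 h2
  push_cast
  calc _ = 2 * (s / l) * Real.exp (-(l / 2) * ‖x‖ ^ 2) := by ring
    _ ≤ _ := this
    _ = _ := by ring

lemma le_Ex {l s R : ℝ} (hl : 0 < l) (hs : 0 < s) {x : ES n} (hx : ‖x‖ ≤ R) :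
    Real.exp (2 / l * Real.exp (-(l / 2) * R ^ 2) * s) ≤ Ex l s x ^ 2 := by
  unfold Ex
  rw [← Real.exp_nat_mul, ph_eq]
  apply Real.exp_le_exp.2
  have h1 : Real.exp (-(l / 2) * R ^ 2) ≤ Real.exp (-(l / 2) * ‖x‖ ^ 2) := by
    apply Real.exp_le_exp.2
    have : ‖x‖ ^ 2 ≤ R ^ 2 := pow_le_pow_left₀ (norm_nonneg _) hx 2
    nlinarith
  have h2 : 0 ≤ 2 * (s / l) := by positivity
  have := mul_le_mul_of_nonneg_left h1 h2
  push_cast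
  calc _ = 2 * (s / l) * Real.exp (-(l / 2) * R ^ 2) := by ring
    _ ≤ _ := this
    _ = _ := by ring

theorem three_norm (n : ℕ) (κ M M1 : ℝ) (hκ : 0 < κ) (hM : 0 < M) (hM1 : 0 < M1) :
    ∃ C : ℝ, 0 < C ∧ ∃ t : ℝ, 0 < t ∧ t < 1 ∧ ∀ A : Fin n → Fin n → ES n → ℝ, Good κ M A →
      ∀ v : ES n → ℝ, ContDiff ℝ 2 v → (∀ x, ‖x‖ < 3 → Lop A v x ^ 2 ≤ M1 * hd v x) →
      ∫ x in ball 0 2, hd v x ≤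
        C * ((∫ x in ball 0 1, hd v x) ^ t * (∫ x in ball 0 3, hd v x) ^ (1 - t)) := by
  obtain ⟨l, hl, c, hc, s0, hs0, hcar⟩ := carleman n κ M hκ hM
  obtain ⟨η, hη, hηc, hηs, hη1, H, hH, hηb⟩ := cutoff n
  set C1 : ℝ := 3 * (H ^ 2 * M1 + (2 * (n * (H * (n * M)))) ^ 2 + (n * (n * (M * H + M * H))) ^ 2)
    with hC1
  have hC1p : 0 < C1 := by positivity
  set T0 : ℝ := 2 / l * Real.exp (-(l / 2) * 0 ^ 2) with hT0
  set T2 : ℝ := 2 / l * Real.exp (-(l / 2) * 2 ^ 2) with hT2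
  set T3 : ℝ := 2 / l * Real.exp (-(l / 2) * (11 / 4) ^ 2) with hT3
  have hll : 0 < 2 / l := by positivity
  have ha : 0 < T0 - T2 := by
    rw [hT0, hT2, sub_pos]
    exact mul_lt_mul_of_pos_left (Real.exp_lt_exp.2 (by nlinarith)) hll
  have hb : 0 < T2 - T3 := by
    rw [hT3, hT2, sub_pos]
    exact mul_lt_mul_of_pos_left (Real.exp_lt_exp.2 (by nlinarith)) hll
  set s1 : ℝ := max s0 (2 * M1 / c) with hs1
  set C2 : ℝ := 1 + 2 * C1 / c with hC2
  have hC2p : 0 < C2 := by positivity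
  refine ⟨2 * C2 + Real.exp ((T2 - T3) * s1), by positivity, (T2 - T3) / ((T0 - T2) + (T2 - T3)),
    by positivity, ?_, ?_⟩
  · rw [div_lt_one (by positivity)]; linarith
  intro A hA v hv hL
  have m1 : (0:ℝ) ≤ ∫ x in ball 0 1, hd v x := integral_nonneg fun x => hd_nonneg v x
  have m2 : (0:ℝ) ≤ ∫ x in ball 0 2, hd v x := integral_nonneg fun x => hd_nonneg v x
  have m3 : (0:ℝ) ≤ ∫ x in ball 0 3, hd v x := integral_nonneg fun x => hd_nonneg v x
  refine interp (T0 - T2) (T2 - T3) C2 s1 ha hb hC2p _ _ _ m1 m2 ?_ ?_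
  · exact setIntegral_mono_set (hd_intOn hv 3) (Filter.Eventually.of_forall fun x => hd_nonneg v x)
      (ball_subset_ball (by norm_num)).eventuallyLE
  intro s hs
  have hss0 : s0 ≤ s := (le_max_left _ _).trans hs
  have hsM : 2 * M1 / c ≤ s := (le_max_right _ _).trans hs
  have hs1' : 1 ≤ s := hs0.trans hss0
  have hsp : 0 < s := by linarith
  set u : ES n → ℝ := fun y => η y * v y with hu
  have huc : ContDiff ℝ 2 u := hη.mul hv
  have hus : HasCompactSupport u := hηc.mul_right
  have hut : ∀ x ∈ tsupport u, 1 / 2 ≤ ‖x‖ ∧ ‖x‖ < 3 := fun x hx =>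
    hηs x (closure_mono (by
      intro y hy; simp only [hu, Function.mem_support] at hy ⊢
      exact left_ne_zero_of_mul hy) hx)
  have hmid : ∀ x : ES n, 3 / 4 < ‖x‖ → ‖x‖ < 11 / 4 → u =ᶠ[nhds x] v := by
    intro x h1 h2
    have o1 : IsOpen {x : ES n | 3 / 4 < ‖x‖} := isOpen_lt continuous_const continuous_norm
    have o2 : IsOpen {x : ES n | ‖x‖ < 11 / 4} := isOpen_lt continuous_norm continuous_const
    filter_upwards [o1.mem_nhds h1, o2.mem_nhds h2] with y hy1 hy2
    simp [hu, hη1 y hy1 hy2]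
  have hmidh : ∀ x : ES n, 3 / 4 < ‖x‖ → ‖x‖ < 11 / 4 → hd u x = hd v x := by
    intro x h1 h2
    have h := hmid x h1 h2
    simp only [hd, gr, h.eq_of_nhds, pd_congr h]
  have hmidL : ∀ x : ES n, 3 / 4 < ‖x‖ → ‖x‖ < 11 / 4 → Lop A u x = Lop A v x := by
    intro x h1 h2
    have h := hmid x h1 h2
    unfold Lop
    refine Finset.sum_congr rfl fun i _ => pd_congr ?_
    filter_upwards [h.eventuallyEq_nhds] with y hy
    simp only [fl, pd_congr hy]
  have hcm := hcar s hss0 A hA u huc hus hut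
  have iU : Integrable (fun x => Ex l s x ^ 2 * hd u x) := by
    refine Continuous.integrable_of_hasCompactSupport
      (((Ex_c (k := 2) l s).continuous.pow 2).mul (hd_cont huc)) ?_
    refine HasCompactSupport.intro hus (fun x hx => ?_)
    simp [hd, gr_zero hx, image_eq_zero_of_notMem_tsupport hx]
  have iL : Integrable (fun x => Ex l s x ^ 2 * Lop A u x ^ 2) := by
    refine Continuous.integrable_of_hasCompactSupport
      (((Ex_c (k := 2) l s).continuous.pow 2).mul ((Lop_cont hA.c1 huc).pow 2)) ?_
    refine HasCompactSupport.intro hus (fun x hx => ?_)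
    simp [Lop_zero hx]
  have iI : ∀ R : ℝ, Integrable ((ball (0:ES n) R).indicator (hd v)) := fun R =>
    (integrable_indicator_iff measurableSet_ball).2 (hd_intOn hv R)
  have nI : ∀ (R : ℝ) (x : ES n), 0 ≤ (ball (0:ES n) R).indicator (hd v) x := fun R x =>
    indicator_nonneg (fun y _ => hd_nonneg v y) x
  have vI : ∀ (R : ℝ) (x : ES n), ‖x‖ < R → (ball (0:ES n) R).indicator (hd v) x = hd v x :=
    fun R x hx => indicator_of_mem (by simpa using hx) _
  have up : ∀ x, Ex l s x ^ 2 * Lop A u x ^ 2 ≤ M1 * (Ex l s x ^ 2 * hd u x)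
      + C1 * (Real.exp (T0 * s) * (ball (0:ES n) 1).indicator (hd v) x
        + Real.exp (T3 * s) * (ball (0:ES n) 3).indicator (hd v) x) := by
    intro x
    have p1 := mul_nonneg (Real.exp_pos (T0 * s)).le (nI 1 x)
    have p3 := mul_nonneg (Real.exp_pos (T3 * s)).le (nI 3 x)
    have q1 := mul_nonneg hC1p.le p1
    have q3 := mul_nonneg hC1p.le p3
    have pE : 0 < Ex l s x ^ 2 := pow_pos (Ex_pos l s x) 2
    have pU : 0 ≤ M1 * (Ex l s x ^ 2 * hd u x) :=
      mul_nonneg hM1.le (mul_nonneg pE.le (hd_nonneg u x))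
    rcases lt_or_ge ‖x‖ 3 with h3 | h3
    · have cut := Lop_cut hM hH hA hη hv h3 (hηb x) (hL x h3)
      rw [← hC1] at cut
      have hv0 := hd_nonneg v x
      rcases le_or_gt ‖x‖ (3 / 4) with h34 | h34
      · have e := Ex_le (x := x) hl hsp le_rfl (norm_nonneg x)
        have : Ex l s x ^ 2 * Lop A u x ^ 2 ≤ Real.exp (T0 * s) * (C1 * hd v x) :=
          mul_le_mul e cut (sq_nonneg _) (Real.exp_pos _).le
        rw [vI 1 x (by linarith)] at q1 ⊢
        linarith
      · rcases lt_or_ge ‖x‖ (11 / 4) with h11 | h11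
        · rw [hmidL x h34 h11, hmidh x h34 h11]
          have := mul_le_mul_of_nonneg_left (hL x h3) pE.le
          linarith
        · have e := Ex_le (x := x) hl hsp (by norm_num) h11
          have : Ex l s x ^ 2 * Lop A u x ^ 2 ≤ Real.exp (T3 * s) * (C1 * hd v x) :=
            mul_le_mul e cut (sq_nonneg _) (Real.exp_pos _).le
          rw [vI 3 x h3] at q3 ⊢
          linarith
    · have hx : x ∉ tsupport u := fun hx => absurd (hut x hx).2 (not_lt.2 h3)
      rw [Lop_zero hx]
      linarith
  have iR : Integrable (fun x => Real.exp (T0 * s) * (ball (0:ES n) 1).indicator (hd v) x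
        + Real.exp (T3 * s) * (ball (0:ES n) 3).indicator (hd v) x) :=
    ((iI 1).const_mul _).add ((iI 3).const_mul _)
  have UP := integral_mono iL ((iU.const_mul M1).add (iR.const_mul C1)) up
  simp only [Pi.add_apply] at UP
  rw [integral_add (iU.const_mul M1) (iR.const_mul C1), integral_const_mul, integral_const_mul,
    integral_add ((iI 1).const_mul _) ((iI 3).const_mul _), integral_const_mul, integral_const_mul,
    integral_indicator measurableSet_ball, integral_indicator measurableSet_ball] at UP
  have lo : ∀ x, Real.exp (T2 * s) * (ball (0:ES n) 2).indicator (hd v) x ≤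
      Real.exp (T2 * s) * (ball (0:ES n) 1).indicator (hd v) x + Ex l s x ^ 2 * hd u x := by
    intro x
    have p1 := mul_nonneg (Real.exp_pos (T2 * s)).le (nI 1 x)
    have pE : 0 < Ex l s x ^ 2 := pow_pos (Ex_pos l s x) 2
    have pU : 0 ≤ Ex l s x ^ 2 * hd u x := mul_nonneg pE.le (hd_nonneg u x)
    rcases lt_or_ge ‖x‖ 2 with h2 | h2
    · rw [vI 2 x h2]
      rcases le_or_gt ‖x‖ (3 / 4) with h34 | h34
      · rw [vI 1 x (by linarith)]; linarith
      · rw [hmidh x h34 (by linarith)]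
        have : Real.exp (T2 * s) * hd v x ≤ Ex l s x ^ 2 * hd v x :=
          mul_le_mul_of_nonneg_right (le_Ex (x := x) hl hsp h2.le) (hd_nonneg v x)
        linarith only [this, p1]
    · rw [indicator_of_notMem (by simpa using h2)]; linarith
  have LO := integral_mono ((iI 2).const_mul _) (((iI 1).const_mul _).add iU) lo
  simp only [Pi.add_apply] at LO
  rw [integral_add ((iI 1).const_mul _) iU, integral_const_mul, integral_const_mul,
    integral_indicator measurableSet_ball, integral_indicator measurableSet_ball] at LO
  have hIU : 0 ≤ ∫ x, Ex l s x ^ 2 * hd u x :=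
    integral_nonneg fun x => mul_nonneg (sq_nonneg _) (hd_nonneg u x)
  change c * s * ∫ x, Ex l s x ^ 2 * hd u x ≤ _ at hcm
  generalize (∫ x, Ex l s x ^ 2 * hd u x) = I at *
  generalize (∫ x, Ex l s x ^ 2 * Lop A u x ^ 2) = J at *
  generalize (∫ x in ball 0 1, hd v x) = N1 at *
  generalize (∫ x in ball 0 2, hd v x) = N2 at *
  generalize (∫ x in ball 0 3, hd v x) = N3 at *
  have k1 : M1 ≤ c * s / 2 := by
    rw [div_le_iff₀ hc] at hsM; linarith
  have k2 : c / 2 * I ≤ C1 * (Real.exp (T0 * s) * N1 + Real.exp (T3 * s) * N3) := by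
    have h1 := mul_le_mul_of_nonneg_right k1 hIU
    have h2 : c / 2 * I ≤ c * s / 2 * I := mul_le_mul_of_nonneg_right (by nlinarith) hIU
    linarith
  have k3 : I ≤ 2 * C1 / c * (Real.exp (T0 * s) * N1 + Real.exp (T3 * s) * N3) := by
    rw [div_mul_eq_mul_div, le_div_iff₀ hc]; linarith
  have k4 : Real.exp (T2 * s) * N1 ≤ Real.exp (T0 * s) * N1 :=
    mul_le_mul_of_nonneg_right (Real.exp_le_exp.2 (by nlinarith)) m1
  have k5 : 0 ≤ Real.exp (T3 * s) * N3 := mul_nonneg (Real.exp_pos _).le m3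
  have k6 : Real.exp (T2 * s) * N2 ≤ C2 * (Real.exp (T0 * s) * N1 + Real.exp (T3 * s) * N3) := by
    rw [hC2]; linarith
  have e1 : Real.exp (T0 * s) = Real.exp (T2 * s) * Real.exp ((T0 - T2) * s) := by
    rw [← Real.exp_add]; ring_nf
  have e2 : Real.exp (T3 * s) = Real.exp (T2 * s) * Real.exp (-((T2 - T3) * s)) := by
    rw [← Real.exp_add]; ring_nf
  rw [e1, e2] at k6
  refine le_of_mul_le_mul_left ?_ (Real.exp_pos (T2 * s))
  linarith

end Norm3

section Scale
variable {n : ℕ}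

lemma ball_sub_of_frontier {Ω : Set (ES n)} (hΩ : IsOpen Ω) {y : ES n} (hy : y ∈ Ω)
    (hρ : 0 < infDist y (frontier Ω)) : ball y (infDist y (frontier Ω)) ⊆ Ω := by
  refine (convex_ball y _).isPreconnected.subset_of_closure_inter_subset hΩ
    ⟨y, mem_ball_self hρ, hy⟩ ?_
  rintro x ⟨hx1, hx2⟩
  by_contra hx
  have hf : x ∈ frontier Ω := by
    rw [hΩ.frontier_eq]; exact ⟨hx1, hx⟩
  have := infDist_le_dist_of_mem (x := y) hf
  rw [mem_ball, dist_comm] at hx2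
  linarith

lemma pd_aff (f : ES n → ℝ) (y : ES n) (r : ℝ) (i : Fin n) (x : ES n) :
    pd i (fun x => f (y + r • x)) x = r * pd i f (y + r • x) := by
  unfold pd
  have h1 := fderiv_comp_smul (𝕜 := ℝ) (f := fun z => f (y + z)) (x := x) r
  rw [h1, fderiv_comp_add_left]
  simp

lemma chi_exists {R : ℝ} (hR : 3 < R) : ∃ χ : ES n → ℝ, ContDiff ℝ 2 χ ∧
    (∀ x, ‖x‖ < 3 → χ x = 1) ∧ ∀ x, x ∈ tsupport χ → ‖x‖ < R := by
  let f : ContDiffBump (0 : ES n) := ⟨3, (3 + R) / 2, by norm_num, by linarith⟩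
  refine ⟨f, f.contDiff, fun x hx => f.one_of_mem_closedBall (by simpa [f] using hx.le), ?_⟩
  intro x hx
  rw [f.tsupport_eq] at hx
  have : ‖x‖ ≤ (3 + R) / 2 := by simpa [f] using hx
  linarith

lemma glob_c {k : WithTop ℕ∞} (hk : k ≤ 2) {Ω : Set (ES n)} (hΩ : IsOpen Ω) {χ f : ES n → ℝ}
    (hχ : ContDiff ℝ 2 χ) {y : ES n} {r : ℝ} (hin : ∀ x ∈ tsupport χ, y + r • x ∈ Ω)
    (hf : ContDiffOn ℝ k f Ω) : ContDiff ℝ k (fun x => χ x * f (y + r • x)) := by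
  rw [contDiff_iff_contDiffAt]
  intro x
  by_cases hx : x ∈ tsupport χ
  · have h1 : ContDiffAt ℝ k f (y + r • x) := hf.contDiffAt (hΩ.mem_nhds (hin x hx))
    have h2 : ContDiffAt ℝ k (fun x : ES n => y + r • x) x := by fun_prop
    exact ((hχ.of_le hk).contDiffAt).mul (h1.comp x h2)
  · have : (fun x => χ x * f (y + r • x)) =ᶠ[nhds x] fun _ => 0 := by
      filter_upwards [(notMem_tsupport_iff_eventuallyEq.1 hx)] with z hz
      simp [hz]
    exact contDiffAt_const.congr_of_eventuallyEq this

lemma glob_near {χ f : ES n → ℝ} (h1 : ∀ x, ‖x‖ < 3 → χ x = 1) (y : ES n) (r : ℝ) {x : ES n}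
    (hx : ‖x‖ < 3) : (fun x => χ x * f (y + r • x)) =ᶠ[nhds x] fun x => f (y + r • x) := by
  have o : IsOpen {x : ES n | ‖x‖ < 3} := isOpen_lt continuous_norm continuous_const
  filter_upwards [o.mem_nhds hx] with z hz
  simp [h1 z hz]

lemma setIntegral_aff (F : ES n → ℝ) (y : ES n) {r : ℝ} (hr : 0 < r) (k : ℝ) :
    ∫ x in ball 0 k, F (y + r • x) = (r ^ n)⁻¹ * ∫ x in ball y (k * r), F x := by
  have h1 := Measure.setIntegral_comp_smul_of_pos (volume : Measure (ES n)) (fun z => F (y + z))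
    (ball 0 k) hr
  rw [h1, _root_.smul_ball hr.ne', finrank_euclideanSpace_fin, smul_eq_mul, smul_zero,
    Real.norm_of_nonneg hr.le]
  congr 1
  have h2 := (measurePreserving_add_left (volume : Measure (ES n)) y).setIntegral_preimage_emb
    (MeasurableEquiv.addLeft y).measurableEmbedding F (ball y (k * r))
  rw [← h2]
  congr 2
  ext x
  simp [mul_comm]

lemma ae_le_on {Ω : Set (ES n)} (hΩ : IsOpen Ω) {f g : ES n → ℝ} (hf : ContinuousOn f Ω)
    (hg : ContinuousOn g Ω) (h : ∀ᵐ x ∂(volume.restrict Ω), f x ≤ g x) : ∀ x ∈ Ω, f x ≤ g x := by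
  have he : (fun x => max (f x) (g x)) =ᵐ[volume.restrict Ω] g := by
    filter_upwards [h] with x hx
    exact max_eq_right hx
  have := Measure.eqOn_open_of_ae_eq he hΩ (hf.sup hg) hg
  intro x hx
  have h2 := this hx
  exact max_eq_right_iff.1 h2

lemma pd_contDiffOn {Ω : Set (ES n)} (hΩ : IsOpen Ω) {v : ES n → ℝ} (hv : ContDiffOn ℝ 2 v Ω)
    (i : Fin n) : ContDiffOn ℝ 1 (pd i v) Ω := by
  have h : ContDiffOn ℝ 1 (fderiv ℝ v) Ω := hv.fderiv_of_isOpen hΩ (by norm_num)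
  unfold pd
  exact h.clm_apply contDiffOn_const

lemma pd_continuousOn {Ω : Set (ES n)} (hΩ : IsOpen Ω) {v : ES n → ℝ} (hv : ContDiffOn ℝ 1 v Ω)
    (i : Fin n) : ContinuousOn (pd i v) Ω := by
  have h : ContinuousOn (fderiv ℝ v) Ω := hv.continuousOn_fderiv_of_isOpen hΩ (by norm_num)
  unfold pd
  exact h.clm_apply continuousOn_const

/-- The equation gives a pointwise bound of the principal part. -/
lemma eq_bound {Ω : Set (ES n)} (hΩ : IsOpen Ω) {M₀ : ℝ} (hM : 0 < M₀)
    {A : Fin n → Fin n → ES n → ℝ} (hA : ∀ i j, ContDiffOn ℝ 1 (A i j) Ω)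
    {b : ES n → ES n} {c : ES n → ℝ}
    (hb : ∀ᵐ x ∂(volume.restrict Ω), ‖b x‖ ≤ M₀) (hc : ∀ᵐ x ∂(volume.restrict Ω), |c x| ≤ M₀)
    {v : ES n → ℝ} (hv : ContDiffOn ℝ 2 v Ω)
    (he : ∀ x ∈ Ω, (∑ i, ∑ j, pd i (fun z => A i j z * pd j v z) x) +
              (∑ i, b x i * pd i v x) + c x * v x = 0) :
    ∀ x ∈ Ω, (∑ i, ∑ j, pd i (fun z => A i j z * pd j v z) x) ^ 2 ≤ 2 * M₀ ^ 2 * hd v x := by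
  have hp : ∀ i, ContinuousOn (pd i v) Ω := fun i => pd_continuousOn hΩ (hv.of_le (by norm_num)) i
  refine ae_le_on hΩ ?_ ?_ ?_
  · refine ContinuousOn.pow (continuousOn_finsetSum _ fun i _ =>
      continuousOn_finsetSum _ fun j _ => ?_) 2
    exact pd_continuousOn hΩ ((hA i j).mul (pd_contDiffOn hΩ hv j)) i
  · simp only [hd, gr_sq]
    exact continuousOn_const.mul ((hv.continuousOn.pow 2).add
      (continuousOn_finsetSum _ fun i _ => (hp i).pow 2))
  · filter_upwards [hb, hc, ae_restrict_mem hΩ.measurableSet] with x h1 h2 hx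
    have e := he x hx
    have cs := Finset.sum_mul_sq_le_sq_mul_sq Finset.univ (fun i => b x i) (fun i => pd i v x)
    have nb : ∑ i, b x i ^ 2 = ‖b x‖ ^ 2 := by rw [EuclideanSpace.real_norm_sq_eq]
    rw [nb, ← gr_sq] at cs
    have h1' : ‖b x‖ ^ 2 ≤ M₀ ^ 2 := pow_le_pow_left₀ (norm_nonneg _) h1 2
    have h2' : c x ^ 2 ≤ M₀ ^ 2 := sq_le_sq.2 (h2.trans (le_abs_self _))
    have q1 := mul_le_mul_of_nonneg_right h1' (sq_nonneg (gr v x))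
    have q2 := mul_le_mul_of_nonneg_right h2' (sq_nonneg (v x))
    unfold hd
    generalize (∑ i, ∑ j, pd i (fun z => A i j z * pd j v z) x) = G at *
    generalize (∑ i, b x i * pd i v x) = B at *
    have hG : G = -(B + c x * v x) := by linarith
    have : G ^ 2 ≤ 2 * (B ^ 2 + (c x * v x) ^ 2) := by
      rw [hG]; nlinarith only [sq_nonneg (B - c x * v x)]
    rw [mul_pow (c x)] at this
    linarith

lemma final_scalar {C t q w r S1 S2 S3 N1 N2 N3 : ℝ} (hC : 0 < C) (ht : 0 < t) (ht1 : t < 1)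
    (hq : 0 < q) (hw : 0 < w) (hr : 0 < r) (s1 : 0 ≤ S1) (s2 : 0 ≤ S2) (s3 : 0 ≤ S3)
    (n1 : 0 ≤ N1) (n3 : 0 ≤ N3)
    (h : N2 ≤ C * (N1 ^ t * N3 ^ (1 - t))) (h1 : N1 ≤ q * (w * S1)) (h3 : N3 ≤ q * (w * S3))
    (h2 : r ^ 2 * (w * S2) ≤ q * N2) :
    r * S2 ^ (1 / 2 : ℝ) ≤ (q * C ^ (1 / 2 : ℝ)) * (S1 ^ (1 / 2 : ℝ)) ^ t
      * (S3 ^ (1 / 2 : ℝ)) ^ (1 - t) := by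
  have ht1' : 0 < 1 - t := by linarith
  have a1 : N1 ^ t ≤ (q * w) ^ t * S1 ^ t := by
    rw [← Real.mul_rpow (by positivity) s1]
    exact Real.rpow_le_rpow n1 (by linarith) ht.le
  have a3 : N3 ^ (1 - t) ≤ (q * w) ^ (1 - t) * S3 ^ (1 - t) := by
    rw [← Real.mul_rpow (by positivity) s3]
    exact Real.rpow_le_rpow n3 (by linarith) ht1'.le
  have a := mul_le_mul a1 a3 (Real.rpow_nonneg n3 _) (by positivity)
  have e : (q * w) ^ t * S1 ^ t * ((q * w) ^ (1 - t) * S3 ^ (1 - t))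
      = (q * w) * (S1 ^ t * S3 ^ (1 - t)) := by
    have : (q * w) ^ t * (q * w) ^ (1 - t) = q * w := by
      rw [← Real.rpow_add (by positivity)]; simp
    linear_combination (S1 ^ t * S3 ^ (1 - t)) * this
  rw [e] at a
  have k : r ^ 2 * S2 ≤ q ^ 2 * C * (S1 ^ t * S3 ^ (1 - t)) := by
    refine le_of_mul_le_mul_left ?_ hw
    have := mul_le_mul_of_nonneg_left a (mul_pos hq hC).le
    have h' := mul_le_mul_of_nonneg_left h hq.le
    nlinarith only [this, h', h2]
  have k2 := Real.rpow_le_rpow (by positivity) k (by norm_num : (0:ℝ) ≤ 1 / 2)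
  have sq : ∀ x : ℝ, 0 ≤ x → (x ^ 2) ^ (1 / 2 : ℝ) = x := by
    intro x hx; rw [← Real.sqrt_eq_rpow, Real.sqrt_sq hx]
  rw [Real.mul_rpow (by positivity) s2, sq r hr.le, Real.mul_rpow (by positivity) (by positivity),
    Real.mul_rpow (by positivity) hC.le, sq q hq.le,
    Real.mul_rpow (by positivity) (by positivity), ← Real.rpow_mul s1, ← Real.rpow_mul s3,
    mul_comm t, mul_comm (1 - t), Real.rpow_mul s1, Real.rpow_mul s3] at k2
  linarith

end Scale

theorem three_main {n : ℕ} (hn : 2 ≤ n) (κ M₀ d : ℝ) (hκ : 0 < κ) (hM₀ : 0 < M₀) (hd' : 0 < d) :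
    ∃ C > 0, ∃ s : ℝ, 0 < s ∧ s < 1 ∧
      ∀ Ω : Set (EuclideanSpace ℝ (Fin n)), IsOpen Ω → Bornology.IsBounded Ω →
        Metric.diam Ω ≤ d →
        ∀ A : Fin n → Fin n → EuclideanSpace ℝ (Fin n) → ℝ,
          (∀ i j, ∀ x ∈ closure Ω, A i j x = A j i x) →
          (∀ i j, ContDiffOn ℝ 1 (A i j) (closure Ω)) →
          (∀ i j, ∀ x ∈ closure Ω, |A i j x| ≤ M₀) →
          (∀ i j, LipschitzOnWith (Real.toNNReal M₀) (A i j) (closure Ω)) →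
          (∀ x ∈ Ω, ∀ ξ : EuclideanSpace ℝ (Fin n),
            κ * ‖ξ‖ ^ 2 ≤ ∑ i, ∑ j, A i j x * ξ i * ξ j) →
        ∀ b : EuclideanSpace ℝ (Fin n) → EuclideanSpace ℝ (Fin n),
        ∀ c : EuclideanSpace ℝ (Fin n) → ℝ,
          (∀ᵐ x ∂(volume.restrict Ω), ‖b x‖ ≤ M₀) →
          (∀ᵐ x ∂(volume.restrict Ω), |c x| ≤ M₀) →
        ∀ v : EuclideanSpace ℝ (Fin n) → ℝ, ContDiffOn ℝ 2 v Ω →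
          (∀ x ∈ Ω, (∑ i, ∑ j, pd i (fun z => A i j z * pd j v z) x) +
              (∑ i, b x i * pd i v x) + c x * v x = 0) →
        ∀ y ∈ Ω, ∀ r : ℝ, 0 < r → r < infDist y (frontier Ω) / 3 →
          r * H1Norm (ball y (2 * r)) v ≤
            C * (H1Norm (ball y r) v) ^ s * (H1Norm (ball y (3 * r)) v) ^ (1 - s) := by
  obtain ⟨C, hC, t, ht, ht1, H⟩ := three_norm n κ (M₀ * (1 + d)) (2 * M₀ ^ 2 * (d ^ 2 + d ^ 4)) hκ
    (by positivity) (by positivity)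
  refine ⟨(1 + d ^ 2) * C ^ (1 / 2 : ℝ), by positivity, t, ht, ht1, ?_⟩
  intro Ω hΩ hbd hdiam A hsym hC1 hAb hLip hell b c hb hc v hv heq y hy r hr hrρ
  set ρ := infDist y (frontier Ω) with hρ
  have h3r : 3 * r < ρ := by linarith
  have hsub : ball y ρ ⊆ Ω := ball_sub_of_frontier hΩ hy (by rw [← hρ]; linarith)
  have hmem : ∀ x : ES n, ‖x‖ < ρ / r → y + r • x ∈ Ω := by
    intro x hx
    apply hsub
    rw [mem_ball, dist_eq_norm, add_sub_cancel_left, norm_smul, Real.norm_of_nonneg hr.le]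
    rw [lt_div_iff₀ hr] at hx
    linarith
  have hR : 3 < ρ / r := by rw [lt_div_iff₀ hr]; linarith
  have hmem3 : ∀ x : ES n, ‖x‖ < 3 → y + r • x ∈ Ω := fun x hx => hmem x (hx.trans hR)
  have hrd : r ≤ d := by
    have h1 : y + r • (EuclideanSpace.single (⟨0, by omega⟩ : Fin n) (1:ℝ)) ∈ Ω :=
      hmem3 _ (by simp)
    have := dist_le_diam_of_mem hbd h1 hy
    rw [dist_eq_norm, add_sub_cancel_left, norm_smul, Real.norm_of_nonneg hr.le] at this
    simp at this
    linarith
  obtain ⟨χ, hχ, hχ1, hχs⟩ := chi_exists (n := n) hR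
  have hin : ∀ x ∈ tsupport χ, y + r • x ∈ Ω := fun x hx => hmem x (hχs x hx)
  have hAΩ : ∀ i j, ContDiffOn ℝ 1 (A i j) Ω := fun i j => (hC1 i j).mono subset_closure
  set v' : ES n → ℝ := fun x => χ x * v (y + r • x) with hv'
  set A' : Fin n → Fin n → ES n → ℝ := fun i j x => χ x * A i j (y + r • x) with hA'
  have cv : ContDiff ℝ 2 v' := glob_c le_rfl hΩ hχ hin hv
  have nv : ∀ x : ES n, ‖x‖ < 3 → v' =ᶠ[nhds x] fun x => v (y + r • x) := fun x hx =>
    glob_near hχ1 y r hx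
  have nA : ∀ i j, ∀ x : ES n, ‖x‖ < 3 → A' i j =ᶠ[nhds x] fun x => A i j (y + r • x) :=
    fun i j x hx => glob_near hχ1 y r hx
  have pv : ∀ i, ∀ x : ES n, ‖x‖ < 3 → pd i v' x = r * pd i v (y + r • x) := fun i x hx => by
    rw [pd_congr (nv x hx), pd_aff]
  have good : Good κ (M₀ * (1 + d)) A' := by
    refine ⟨fun i j => glob_c (by norm_num) hΩ hχ hin (hAΩ i j), ?_, ?_, ?_, ?_⟩
    · intro i j x
      by_cases hx : x ∈ tsupport χ
      · simp only [hA', hsym i j _ (subset_closure (hin x hx))]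
      · simp [hA', image_eq_zero_of_notMem_tsupport hx]
    · intro i j x hx
      rw [(nA i j x hx).eq_of_nhds]
      have := hAb i j _ (subset_closure (hmem3 x hx))
      nlinarith
    · intro i j k x hx
      rw [pd_congr (nA i j x hx), pd_aff, abs_mul, abs_of_pos hr]
      have hz := hmem3 x hx
      have h1 := norm_fderiv_le_of_lipschitzOn ℝ
        (Filter.mem_of_superset (hΩ.mem_nhds hz) subset_closure) (hLip i j)
      rw [Real.coe_toNNReal _ hM₀.le] at h1
      have h2 : |pd k (A i j) (y + r • x)| ≤ M₀ := by
        have := (fderiv ℝ (A i j) (y + r • x)).le_opNorm (EuclideanSpace.single k 1)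
        simp only [EuclideanSpace.norm_single, norm_one, mul_one] at this
        exact this.trans h1
      have := mul_le_mul hrd h2 (abs_nonneg _) hd'.le
      nlinarith
    · intro x hx ξ
      simp only [(nA _ _ x hx).eq_of_nhds]
      exact hell _ (hmem3 x hx) ξ
  have hLop : ∀ x : ES n, ‖x‖ < 3 → Lop A' v' x =
      r ^ 2 * ∑ i, ∑ j, pd i (fun z => A i j z * pd j v z) (y + r • x) := by
    intro x hx
    unfold Lop
    rw [Finset.mul_sum]
    refine Finset.sum_congr rfl fun i _ => ?_
    have hz := hmem3 x hx
    have dz : ∀ j, DifferentiableAt ℝ (fun z => A i j z * pd j v z) (y + r • x) := fun j =>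
      (((hAΩ i j).mul (pd_contDiffOn hΩ hv j)).contDiffAt (hΩ.mem_nhds hz)).differentiableAt
        (by norm_num)
    have daff : DifferentiableAt ℝ (fun x : ES n => y + r • x) x := by fun_prop
    have o : IsOpen {x : ES n | ‖x‖ < 3} := isOpen_lt continuous_norm continuous_const
    have he : fl A' v' i =ᶠ[nhds x]
        fun x => r * (fun z => ∑ j, A i j z * pd j v z) (y + r • x) := by
      filter_upwards [o.mem_nhds hx] with w hw
      simp only [fl, Finset.mul_sum]
      refine Finset.sum_congr rfl fun j _ => ?_
      rw [(nA i j w hw).eq_of_nhds, pv j w hw]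
      ring
    have ds : DifferentiableAt ℝ (fun z => ∑ j, A i j z * pd j v z) (y + r • x) :=
      DifferentiableAt.fun_sum fun j _ => dz j
    have dc : DifferentiableAt ℝ (fun x => (fun z => ∑ j, A i j z * pd j v z) (y + r • x)) x :=
      DifferentiableAt.comp (g := fun z => ∑ j, A i j z * pd j v z)
        (f := fun x : ES n => y + r • x) x ds daff
    rw [pd_congr he, pd_const_mul r dc, pd_aff (fun z => ∑ j, A i j z * pd j v z),
      pd_sum fun j _ => dz j]
    ring
  have hhd : ∀ x : ES n, ‖x‖ < 3 → hd v' x = v (y + r • x) ^ 2 + r ^ 2 * gr v (y + r • x) ^ 2 := by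
    intro x hx
    simp only [hd, gr_sq, (nv x hx).eq_of_nhds, Finset.mul_sum]
    congr 1
    refine Finset.sum_congr rfl fun i _ => ?_
    rw [pv i x hx]; ring
  have hb2 := eq_bound hΩ hM₀ hAΩ hb hc hv heq
  have r2 : r ^ 2 ≤ d ^ 2 := pow_le_pow_left₀ hr.le hrd 2
  have r4 : r ^ 4 ≤ d ^ 4 := pow_le_pow_left₀ hr.le hrd 4
  have main := H A' good v' cv (by
    intro x hx
    rw [hLop x hx, hhd x hx, mul_pow]
    have h1 := hb2 _ (hmem3 x hx)
    unfold hd at h1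
    generalize (∑ i, ∑ j, pd i (fun z => A i j z * pd j v z) (y + r • x)) = G at *
    have hg : 0 ≤ gr v (y + r • x) ^ 2 := sq_nonneg _
    have hw : 0 ≤ v (y + r • x) ^ 2 := sq_nonneg _
    generalize gr v (y + r • x) ^ 2 = g at *
    generalize v (y + r • x) ^ 2 = w at *
    have h2 := mul_le_mul_of_nonneg_left h1 (by positivity : 0 ≤ (r ^ 2) ^ 2)
    refine h2.trans ?_
    have k1 : (r ^ 2) ^ 2 * w ≤ (d ^ 2 + d ^ 4) * w :=
      mul_le_mul_of_nonneg_right (by nlinarith only [r4, sq_nonneg d]) hw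
    have k2 : (r ^ 2) ^ 2 * g ≤ (d ^ 2 + d ^ 4) * (r ^ 2 * g) := by
      have e1 := mul_le_mul_of_nonneg_right r2 (by positivity : 0 ≤ r ^ 2 * g)
      have e2 : 0 ≤ d ^ 4 * (r ^ 2 * g) := by positivity
      linarith
    have k3 := mul_le_mul_of_nonneg_left (add_le_add k1 k2) (by positivity : 0 ≤ 2 * M₀ ^ 2)
    linarith)
  set F : ES n → ℝ := fun x => v x ^ 2 + ‖fderiv ℝ v x‖ ^ 2 with hF
  have hFg : ∀ x, F x = v x ^ 2 + gr v x ^ 2 := fun x => by rw [hF, gr_sq, ← normsq_fderiv]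
  have F0 : ∀ x, 0 ≤ F x := fun x => by positivity
  have le1 : ∀ x : ES n, ‖x‖ < 3 → hd v' x ≤ (1 + d ^ 2) * F (y + r • x) := by
    intro x hx
    rw [hhd x hx, hFg]
    have h1 := mul_le_mul_of_nonneg_right r2 (sq_nonneg (gr v (y + r • x)))
    have h2 : 0 ≤ d ^ 2 * v (y + r • x) ^ 2 := by positivity
    have h3 := sq_nonneg (gr v (y + r • x))
    nlinarith only [h1, h2, h3]
  have le2 : ∀ x : ES n, ‖x‖ < 3 → r ^ 2 * F (y + r • x) ≤ (1 + d ^ 2) * hd v' x := by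
    intro x hx
    rw [hhd x hx, hFg]
    have h1 := mul_le_mul_of_nonneg_right r2 (sq_nonneg (v (y + r • x)))
    have h2 : 0 ≤ d ^ 2 * (r ^ 2 * gr v (y + r • x) ^ 2) := by positivity
    have h3 := sq_nonneg (v (y + r • x))
    nlinarith only [h1, h2, h3]
  have iF : ∀ k : ℝ, k ≤ 3 → IntegrableOn (fun x => F (y + r • x)) (ball 0 k) := by
    intro k hk
    have hcont : Continuous fun x => v' x ^ 2 + (r ^ 2)⁻¹ * gr v' x ^ 2 :=
      (cv.continuous.pow 2).add (continuous_const.mul ((gr_cont (cv.of_le (by norm_num))).pow 2))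
    have hi := (hcont.continuousOn.integrableOn_compact (μ := volume)
      (isCompact_closedBall (0 : ES n) k)).mono_set ball_subset_closedBall
    refine hi.congr_fun ?_ measurableSet_ball
    intro x hx
    have hx3 : ‖x‖ < 3 := lt_of_lt_of_le (by simpa using hx) hk
    have h1 := hhd x hx3
    rw [hd, (nv x hx3).eq_of_nhds] at h1
    simp only [hFg, (nv x hx3).eq_of_nhds]
    field_simp
    linarith
  have up : ∀ k : ℝ, k ≤ 3 → ∫ x in ball 0 k, hd v' x ≤
      (1 + d ^ 2) * ((r ^ n)⁻¹ * ∫ x in ball y (k * r), F x) := by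
    intro k hk
    rw [← setIntegral_aff F y hr, ← integral_const_mul]
    exact setIntegral_mono_on (hd_intOn cv k) ((iF k hk).const_mul _) measurableSet_ball
      fun x hx => le1 x (lt_of_lt_of_le (by simpa using hx) hk)
  have lo : r ^ 2 * ((r ^ n)⁻¹ * ∫ x in ball y (2 * r), F x) ≤
      (1 + d ^ 2) * ∫ x in ball 0 2, hd v' x := by
    rw [← setIntegral_aff F y hr, ← integral_const_mul, ← integral_const_mul]
    exact setIntegral_mono_on ((iF 2 (by norm_num)).const_mul _) ((hd_intOn cv 2).const_mul _)
      measurableSet_ball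
      fun x hx => le2 x (lt_of_lt_of_le (by simpa using hx) (by norm_num))
  have u1 := up 1 (by norm_num)
  rw [one_mul] at u1
  exact final_scalar hC ht ht1 (by positivity) (by positivity) hr
    (integral_nonneg F0) (integral_nonneg F0) (integral_nonneg F0)
    (integral_nonneg fun x => hd_nonneg v' x) (integral_nonneg fun x => hd_nonneg v' x)
    main u1 (up 3 le_rfl) lo

theorem stmt_9 {n : ℕ} (hn : 2 ≤ n) (κ M₀ d : ℝ) (hκ : 0 < κ) (hM₀ : 0 < M₀) (hd : 0 < d) :
    ∃ C > 0, ∃ s : ℝ, 0 < s ∧ s < 1 ∧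
      ∀ Ω : Set (EuclideanSpace ℝ (Fin n)), IsOpen Ω → Bornology.IsBounded Ω →
        Metric.diam Ω ≤ d →
        ∀ A : Fin n → Fin n → EuclideanSpace ℝ (Fin n) → ℝ,
          (∀ i j, ∀ x ∈ closure Ω, A i j x = A j i x) →
          (∀ i j, ContDiffOn ℝ 1 (A i j) (closure Ω)) →
          (∀ i j, ∀ x ∈ closure Ω, |A i j x| ≤ M₀) →
          (∀ i j, LipschitzOnWith (Real.toNNReal M₀) (A i j) (closure Ω)) →
          (∀ x ∈ Ω, ∀ ξ : EuclideanSpace ℝ (Fin n),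
            κ * ‖ξ‖ ^ 2 ≤ ∑ i, ∑ j, A i j x * ξ i * ξ j) →
        ∀ b : EuclideanSpace ℝ (Fin n) → EuclideanSpace ℝ (Fin n),
        ∀ c : EuclideanSpace ℝ (Fin n) → ℝ,
          Measurable b → Measurable c →
          (∀ᵐ x ∂(volume.restrict Ω), ‖b x‖ ≤ M₀) →
          (∀ᵐ x ∂(volume.restrict Ω), |c x| ≤ M₀) →
        ∀ v : EuclideanSpace ℝ (Fin n) → ℝ, ContDiffOn ℝ 2 v Ω →
          (∀ x ∈ Ω, (∑ i, ∑ j, pd i (fun z => A i j z * pd j v z) x) +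
              (∑ i, b x i * pd i v x) + c x * v x = 0) →
        ∀ y ∈ Ω, ∀ r : ℝ, 0 < r → r < infDist y (frontier Ω) / 3 →
          r * H1Norm (ball y (2 * r)) v ≤
            C * (H1Norm (ball y r) v) ^ s * (H1Norm (ball y (3 * r)) v) ^ (1 - s) := by
  obtain ⟨C, hC, s, hs, hs1, H⟩ := three_main hn κ M₀ d hκ hM₀ hd
  refine ⟨C, hC, s, hs, hs1, ?_⟩
  intro Ω h1 h2 h3 A h4 h5 h6 h7 h8 b c _ _ h9 h10
  exact H Ω h1 h2 h3 A h4 h5 h6 h7 h8 b c h9 h10
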